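/- arXiv:2511.22428 — 3 statements merged into one kernel-verified Lean document; each statement's English description precedes it below -/
import Mathlib

section
/- Let c, c_T, δ > 0 and t < T with arctan(2c_T·√(δ/c)) + 2(T−t)·√(δc) < π/2, let β(s) = 2√(c/δ)·tan(arctan(2c_T·√(δ/c)) + 2√(δc)·(T−s)) and μ(s) = 2c_T + ∫_s^T [2c + (1/2)·β(τ)·tr(a)] dτ. Then the function z(s,x) := β(s)·|x|²/2 + μ(s) on [t,T]×ℝⁿ satisfies z(T,x) = 2c_T(1+|x|²) and solves the majorant equation −∂_s z(s,x) + 𝒜z(s,x) = (δ/2)·|Dz(s,x)|² + 2c(1+|x|²) for all (s,x) ∈ [t,T]×ℝⁿ. -/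
open Real MeasureTheory Matrix

noncomputable section

abbrev Euc (n : ℕ) := EuclideanSpace ℝ (Fin n)

/-- Second partial derivative `∂²φ/(∂x_i ∂x_j)(x)`. -/
def secondPartial (n : ℕ) (φ : Euc n → ℝ) (x : Euc n) (i j : Fin n) : ℝ :=
  fderiv ℝ (fun y => fderiv ℝ φ y (EuclideanSpace.single j 1)) x (EuclideanSpace.single i 1)

/-- The operator `𝒜φ(x) = −(1/2)·∑_{i,j} a_{ij}·∂²φ/(∂x_i∂x_j)(x)`. -/
def opA (n : ℕ) (a : Matrix (Fin n) (Fin n) ℝ) (φ : Euc n → ℝ) (x : Euc n) : ℝ :=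
  -(1 / 2) * ∑ i, ∑ j, a i j * secondPartial n φ x i j

theorem hasFDerivAt_quadratic {n : ℕ} (b m : ℝ) (x : Euc n) :
    HasFDerivAt (fun y : Euc n => b * ‖y‖ ^ 2 / 2 + m) (b • innerSL ℝ x) x := by
  have h := ((((hasStrictFDerivAt_norm_sq x).hasFDerivAt).const_mul (b / 2)).add_const m)
  convert! h using 1
  · funext y; ring
  · ext v; simp; ring

theorem gradient_quadratic {n : ℕ} (b m : ℝ) (x : Euc n) :
    gradient (fun y : Euc n => b * ‖y‖ ^ 2 / 2 + m) x = b • x := by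
  apply HasGradientAt.gradient
  rw [hasGradientAt_iff_hasFDerivAt]
  convert! hasFDerivAt_quadratic b m x using 1
  ext v
  simp

theorem secondPartial_quadratic {n : ℕ} (b m : ℝ) (x : Euc n) (i j : Fin n) :
    secondPartial n (fun y : Euc n => b * ‖y‖ ^ 2 / 2 + m) x i j = if i = j then b else 0 := by
  have h : (fun y : Euc n => fderiv ℝ (fun y : Euc n => b * ‖y‖ ^ 2 / 2 + m) y
      (EuclideanSpace.single j 1)) = b • innerSL ℝ (EuclideanSpace.single j (1 : ℝ)) := by
    funext y
    rw [(hasFDerivAt_quadratic b m y).fderiv]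
    simp [real_inner_comm]
  rw [secondPartial, h, (b • innerSL ℝ (EuclideanSpace.single j (1 : ℝ))).fderiv]
  simp [EuclideanSpace.inner_single_left, PiLp.single_apply, eq_comm]

theorem opA_quadratic {n : ℕ} (a : Matrix (Fin n) (Fin n) ℝ) (b m : ℝ) (x : Euc n) :
    opA n a (fun y : Euc n => b * ‖y‖ ^ 2 / 2 + m) x = -(1 / 2) * b * a.trace := by
  simp only [opA, secondPartial_quadratic, mul_ite, mul_zero, Finset.sum_ite_eq,
    Finset.mem_univ, if_true, Matrix.trace, Matrix.diag_apply, ← Finset.sum_mul]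
  ring

/-- `s ↦ 2√(c/δ)·tan(α + 2√(δc)(T − s))` solves the Riccati equation `b' = −(4c + δb²)`. -/
theorem hasDerivAt_riccati {c δ : ℝ} (hc : 0 < c) (hδ : 0 < δ) (α T s : ℝ)
    (hcos : cos (α + 2 * √(δ * c) * (T - s)) ≠ 0) :
    HasDerivAt (fun s => 2 * √(c / δ) * tan (α + 2 * √(δ * c) * (T - s)))
      (-(4 * c + δ * (2 * √(c / δ) * tan (α + 2 * √(δ * c) * (T - s))) ^ 2)) s := by
  have hlin : HasDerivAt (fun s => α + 2 * √(δ * c) * (T - s)) (2 * √(δ * c) * -1) s :=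
    (((hasDerivAt_id s).const_sub T).const_mul _).const_add _
  have h := ((hasDerivAt_tan hcos).comp s hlin).const_mul (2 * √(c / δ))
  have hprod : √(c / δ) * √(δ * c) = c := by
    rw [← Real.sqrt_mul (by positivity), show c / δ * (δ * c) = c ^ 2 by field_simp,
      Real.sqrt_sq hc.le]
  have hsq : √(c / δ) ^ 2 * δ = c := by
    rw [Real.sq_sqrt (by positivity)]; field_simp
  refine h.congr_deriv ?_
  rw [one_div, ← Real.inv_one_add_tan_sq hcos, inv_inv]
  generalize tan (α + 2 * √(δ * c) * (T - s)) = u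
  linear_combination (-4 * (1 + u ^ 2)) * hprod + 4 * u ^ 2 * hsq

/-- The function `z(s,x) = β(s)·|x|²/2 + μ(s)` solves the majorant
equation `−∂_s z + 𝒜z = (δ/2)|Dz|² + 2c(1+|x|²)` with `z(T,x) = 2c_T(1+|x|²)`. -/
theorem majorant_equation_solution
    (n : ℕ) (hn : 1 ≤ n) (σM : Matrix (Fin n) (Fin n) ℝ) (hσ : IsUnit σM.det)
    (a : Matrix (Fin n) (Fin n) ℝ) (ha : a = σM * σMᵀ)
    (c cT δ t T : ℝ) (hc : 0 < c) (hcT : 0 < cT) (hδ : 0 < δ) (htT : t < T)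
    (hsmall : arctan (2 * cT * Real.sqrt (δ / c)) + (T - t) * (2 * Real.sqrt (δ * c)) < π / 2)
    (β μ : ℝ → ℝ) (z : ℝ → Euc n → ℝ)
    (hβ : ∀ s, β s = 2 * Real.sqrt (c / δ) *
      Real.tan (arctan (2 * cT * Real.sqrt (δ / c)) + 2 * Real.sqrt (δ * c) * (T - s)))
    (hμ : ∀ s, μ s = 2 * cT + ∫ τ in s..T, (2 * c + (1 / 2) * β τ * a.trace))
    (hz : ∀ s x, z s x = β s * ‖x‖ ^ 2 / 2 + μ s) :
    -- terminal condition
    (∀ x : Euc n, z T x = 2 * cT * (1 + ‖x‖ ^ 2)) ∧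
    -- the majorant equation
    (∀ s ∈ Set.Icc t T, ∀ x : Euc n,
      -(deriv (fun σ' => z σ' x) s) + opA n a (z s) x
        = δ / 2 * ‖gradient (z s) x‖ ^ 2 + 2 * c * (1 + ‖x‖ ^ 2)) := by
  set α := arctan (2 * cT * √(δ / c)) with hα
  have hk : 0 < √(δ * c) := Real.sqrt_pos.2 (by positivity)
  have hα0 : 0 ≤ α := Real.arctan_nonneg.2 (by positivity)
  set U : Set ℝ := {s | α + 2 * √(δ * c) * (T - s) ∈ Set.Ioo (-(π / 2)) (π / 2)} with hU
  have hUo : IsOpen U := isOpen_Ioo.preimage (by fun_prop)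
  have hIU : Set.Icc t T ⊆ U := by
    rintro s ⟨hs, hsT⟩
    have h₁ : 0 ≤ √(δ * c) * (T - s) := mul_nonneg hk.le (by linarith)
    have h₂ : √(δ * c) * (T - s) ≤ √(δ * c) * (T - t) :=
      mul_le_mul_of_nonneg_left (by linarith) hk.le
    constructor <;> linarith [Real.pi_pos]
  have hβd : ∀ s ∈ U, HasDerivAt β (-(4 * c + δ * β s ^ 2)) s := by
    intro s hs
    rw [hβ s, funext hβ]
    exact hasDerivAt_riccati hc hδ α T s (Real.cos_pos_of_mem_Ioo hs).ne'
  have hβc : ContinuousOn β U := fun s hs => (hβd s hs).continuousAt.continuousWithinAt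
  have hfc : ContinuousOn (fun τ => 2 * c + (1 / 2) * β τ * a.trace) U := by fun_prop
  have hμd : ∀ s ∈ Set.Icc t T, HasDerivAt μ (-(2 * c + (1 / 2) * β s * a.trace)) s := by
    intro s hs
    have hsub : Set.uIcc s T ⊆ U := by
      rw [Set.uIcc_of_le hs.2]
      exact (Set.Icc_subset_Icc_left hs.1).trans hIU
    rw [funext hμ]
    exact (intervalIntegral.integral_hasDerivAt_left (hfc.mono hsub).intervalIntegrable
      (hfc.stronglyMeasurableAtFilter hUo s (hIU hs))
      (hfc.continuousAt (hUo.mem_nhds (hIU hs)))).const_add _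
  have hprod : √(c / δ) * √(δ / c) = 1 := by
    rw [← Real.sqrt_mul (by positivity), show c / δ * (δ / c) = 1 by field_simp, Real.sqrt_one]
  refine ⟨fun x => ?_, fun s hs x => ?_⟩
  · rw [hz, hμ, hβ, intervalIntegral.integral_same, sub_self, mul_zero, add_zero, hα,
      Real.tan_arctan]
    linear_combination 2 * cT * ‖x‖ ^ 2 * hprod
  · have hzd : HasDerivAt (fun r => z r x)
        (-(4 * c + δ * β s ^ 2) * ‖x‖ ^ 2 / 2 + -(2 * c + (1 / 2) * β s * a.trace)) s := by
      rw [funext fun r => hz r x]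
      exact (((hβd s (hIU hs)).mul_const _).div_const 2).add (hμd s hs)
    rw [hzd.deriv, funext (hz s), opA_quadratic, gradient_quadratic, norm_smul, mul_pow,
      Real.norm_eq_abs, sq_abs]
    ring

end
end

section
/- (Proposition 5.4, weighted energy estimate for the time derivative.) Let t < T, K > 0 and γ > n/2 + 2. Let Q : [t,T]×ℝⁿ → ℝ be continuous with |Q(s,x)| ≤ K(1+|x|²) and let Q_T : ℝⁿ → ℝ be continuously differentiable with |DQ_T(x)| ≤ K(1+|x|). Let V : [t,T]×ℝⁿ → ℝ be such that ∂_sV, DV, D²V and ∂_sDV exist and are continuous on [t,T]×ℝⁿ, V solves −∂_s V + 𝒜V = Q on [t,T)×ℝⁿ with V(T,·) = Q_T, |DV(s,x)| ≤ K(1+|x|), and for some K′ > 0 also |D²V(s,x)| + |∂_sDV(s,x)| ≤ K′(1+|x|²) (the last bound only to justify the integrations by parts). Then ∫_t^T ∫_{ℝⁿ} |∂_s V(s,x)|²·π_γ(x) dx ds ≤ C, where C is a constant depending only on K, γ, n, the matrix a and T−t (and not on K′ or otherwise on V). -/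
open Real MeasureTheory Matrix

noncomputable section

/-- The weight `π_γ(x) = (1+|x|²)^{−γ}`. -/
def piWeight (n : ℕ) (γ : ℝ) (x : Euc n) : ℝ := (1 + ‖x‖ ^ 2) ^ (-γ)

/-- If `V` is differentiable in both variables and `∂ₛ∇V` is continuous, then `∂ₛV(s, ·)` is
differentiable, with gradient `∂ₛ∇V(s, ·)`. -/
theorem hasGradientAt_deriv_of_continuousOn_deriv_gradient {E : Type*} [NormedAddCommGroup E]
    [InnerProductSpace ℝ E] [CompleteSpace E] {V : ℝ → E → ℝ} {t T s : ℝ}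
    (hs : s ∈ Set.Ico t T)
    (hVs : ∀ x, DifferentiableAt ℝ (fun r => V r x) s)
    (hVx : ∀ r ∈ Set.Icc t T, Differentiable ℝ (V r))
    (hg : ∀ x, ∀ r ∈ Set.Icc t T, DifferentiableAt ℝ (fun r => gradient (V r) x) r)
    (hcont : ContinuousOn (fun p : ℝ × E => deriv (fun r => gradient (V r) p.2) p.1)
      (Set.Icc t T ×ˢ Set.univ)) (x : E) :
    HasGradientAt (fun y => deriv (fun r => V r y) s) (deriv (fun r => gradient (V r) x) s) x := by
  have hsI : s ∈ Set.Icc t T := Set.Ico_subset_Icc_self hs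
  rw [hasGradientAt_iff_hasFDerivAt]
  refine hasFDerivAt_of_tendstoUniformlyOnFilter (𝕜 := ℝ) (l := nhdsWithin s (Set.Ioi s))
    (f := fun r y => (r - s)⁻¹ • (V r y - V s y))
    (f' := fun r y => (r - s)⁻¹ •
      (InnerProductSpace.toDual ℝ E (gradient (V r) y) -
        InnerProductSpace.toDual ℝ E (gradient (V s) y)))
    (g' := fun y => InnerProductSpace.toDual ℝ E (deriv (fun r => gradient (V r) y) s))
    ?_ ?_ ?_
  · rw [Metric.tendstoUniformlyOnFilter_iff]
    intro ε hε
    have hc := hcont (s, x) ⟨hsI, Set.mem_univ _⟩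
    obtain ⟨δ, hδ, hball⟩ := Metric.continuousWithinAt_iff.1 hc (ε / 4) (by positivity)
    have h1 : ∀ᶠ r in nhdsWithin s (Set.Ioi s), r ∈ Set.Ioo s (min T (s + δ)) :=
      Ioo_mem_nhdsGT (lt_min hs.2 (by linarith))
    have h2 : ∀ᶠ y in nhds x, dist y x < δ := Metric.eventually_nhds_iff.2 ⟨δ, hδ, fun _ h => h⟩
    filter_upwards [h1.prod_mk h2] with p hp
    obtain ⟨r, y⟩ := p
    obtain ⟨⟨hr1, hr2⟩, hy⟩ := hp
    simp only at hr1 hr2 hy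
    have hrs : 0 < r - s := by linarith
    have hsub : ∀ u ∈ Set.Icc s r, u ∈ Set.Icc t T := fun u hu =>
      ⟨hs.1.trans hu.1, hu.2.trans (hr2.le.trans (min_le_left _ _))⟩
    have hclose : ∀ u ∈ Set.Icc s r, dist (deriv (fun r => gradient (V r) y) u)
        (deriv (fun r => gradient (V r) x) s) < ε / 4 := by
      intro u hu
      refine hball (x := (u, y)) ⟨hsub u hu, Set.mem_univ _⟩ ?_
      rw [Prod.dist_eq, max_lt_iff]
      refine ⟨?_, hy⟩
      have := min_le_right T (s + δ)
      rw [Real.dist_eq, abs_of_nonneg (by linarith [hu.1])]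
      linarith [hu.2]
    have hmv := (convex_Icc s r).norm_image_sub_le_of_norm_hasDerivWithin_le
      (f := fun u => gradient (V u) y - (u - s) • deriv (fun r => gradient (V r) y) s)
      (f' := fun u => deriv (fun r => gradient (V r) y) u -
        deriv (fun r => gradient (V r) y) s) (C := ε / 2)
      (fun u hu => by
        have h3 := (hg y u (hsub u hu)).hasDerivAt
        have h4 := ((hasDerivAt_id u).sub_const s).smul_const
          (deriv (fun r => gradient (V r) y) s)
        simpa using (h3.fun_sub h4).hasDerivWithinAt)
      (fun u hu => by
        rw [← dist_eq_norm]
        have h3 := dist_triangle_right (deriv (fun r => gradient (V r) y) u)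
          (deriv (fun r => gradient (V r) y) s) (deriv (fun r => gradient (V r) x) s)
        linarith [hclose u hu, hclose s ⟨le_rfl, hr1.le⟩])
      (Set.left_mem_Icc.2 hr1.le) (Set.right_mem_Icc.2 hr1.le)
    simp only [sub_self, zero_smul, sub_zero, Real.norm_eq_abs, abs_of_pos hrs] at hmv
    rw [← map_sub, ← map_smul, dist_comm, (InnerProductSpace.toDual ℝ E).dist_map,
      dist_eq_norm]
    have h5 : (r - s)⁻¹ • (gradient (V r) y - gradient (V s) y) -
        deriv (fun r => gradient (V r) y) s = (r - s)⁻¹ •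
        (gradient (V r) y - (r - s) • deriv (fun r => gradient (V r) y) s -
          gradient (V s) y) := by
      rw [sub_right_comm, smul_sub _ (_ - _), smul_smul, inv_mul_cancel₀ hrs.ne', one_smul]
    rw [h5, norm_smul, norm_inv, Real.norm_eq_abs, abs_of_pos hrs, inv_mul_lt_iff₀ hrs]
    nlinarith
  · have h1 : ∀ᶠ r in nhdsWithin s (Set.Ioi s), r ∈ Set.Ioo s T := Ioo_mem_nhdsGT hs.2
    filter_upwards [h1.prod_inl (nhds x)] with p hp
    have hr : p.1 ∈ Set.Icc t T := ⟨hs.1.trans hp.1.le, hp.2.le⟩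
    exact (((hVx _ hr p.2).hasGradientAt.hasFDerivAt).fun_sub
      ((hVx _ hsI p.2).hasGradientAt.hasFDerivAt)).fun_const_smul _
  · filter_upwards with y
    have := (hasDerivAt_iff_tendsto_slope.1 (hVs y).hasDerivAt).mono_left
      (nhdsWithin_mono s (show Set.Ioi s ⊆ {s}ᶜ from fun r hr => (ne_of_gt hr)))
    exact this

theorem piWeight_pos (n : ℕ) (γ : ℝ) (x : Euc n) : 0 < piWeight n γ x := by
  unfold piWeight; positivity

theorem hasFDerivAt_piWeight (n : ℕ) (γ : ℝ) (x : Euc n) :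
    HasFDerivAt (piWeight n γ)
      ((-(2 * γ) * (piWeight n γ x / (1 + ‖x‖ ^ 2))) • innerSL ℝ x) x := by
  have hx : (0 : ℝ) < 1 + ‖x‖ ^ 2 := by positivity
  have h := (((hasStrictFDerivAt_norm_sq x).hasFDerivAt).const_add 1).rpow_const
    (p := -γ) (Or.inl hx.ne')
  refine h.congr_fderiv ?_
  rw [Real.rpow_sub hx, Real.rpow_one]
  ext v
  simp [piWeight]
  ring

theorem continuous_piWeight (n : ℕ) (γ : ℝ) : Continuous (piWeight n γ) :=
  continuous_iff_continuousAt.2 fun x => (hasFDerivAt_piWeight n γ x).continuousAt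

theorem integrable_sq_mul_piWeight {n : ℕ} {γ : ℝ} (hγ : (n : ℝ) / 2 + 2 < γ) :
    Integrable (fun x : Euc n => (1 + ‖x‖ ^ 2) ^ 2 * piWeight n γ x) := by
  have h := integrable_rpow_neg_one_add_norm_sq (E := Euc n) (μ := volume) (r := 2 * γ - 4)
    (by rw [finrank_euclideanSpace_fin]; linarith)
  convert h using 2 with x
  have hx : (0 : ℝ) < 1 + ‖x‖ ^ 2 := by positivity
  rw [piWeight, ← Real.rpow_natCast, ← Real.rpow_add hx]
  congr 1
  push_cast
  ring

theorem integrable_of_abs_le_sq_mul_piWeight {n : ℕ} {γ : ℝ} (hγ : (n : ℝ) / 2 + 2 < γ)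
    {f : Euc n → ℝ} (hf : Continuous f) {C : ℝ}
    (h : ∀ x, |f x| ≤ C * ((1 + ‖x‖ ^ 2) ^ 2 * piWeight n γ x)) : Integrable f :=
  ((integrable_sq_mul_piWeight hγ).const_mul C).mono' hf.aestronglyMeasurable
    (Filter.Eventually.of_forall h)

/-- Integration by parts against the divergence of a vector field. -/
theorem integral_mul_divergence {n : ℕ} {f : Euc n → ℝ} {p : Euc n → Euc n}
    (hf : ContDiff ℝ 1 f) (hp : ContDiff ℝ 1 p)
    (h1 : Integrable fun x => ‖fderiv ℝ f x‖ * ‖p x‖)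
    (h2 : Integrable fun x => ‖f x‖ * ‖fderiv ℝ p x‖)
    (h3 : Integrable fun x => ‖f x‖ * ‖p x‖) :
    ∫ x, f x * ∑ i, (fderiv ℝ p x (EuclideanSpace.single i 1)) i
      = - ∫ x, fderiv ℝ f x (p x) := by
  have hfd := hf.differentiable one_ne_zero
  have hpd := hp.differentiable one_ne_zero
  have hf' := hf.continuous_fderiv one_ne_zero
  have hp' := hp.continuous_fderiv one_ne_zero
  have hfc := hf.continuous
  have hpc := hp.continuous
  have hpi : ∀ i x, HasFDerivAt (fun y => p y i)
      ((EuclideanSpace.proj i : Euc n →L[ℝ] ℝ) ∘L fderiv ℝ p x) x := fun i x =>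
    (EuclideanSpace.proj i : Euc n →L[ℝ] ℝ).hasFDerivAt.comp x (hpd x).hasFDerivAt
  have hpi' : ∀ i x v, fderiv ℝ (fun y => p y i) x v = (fderiv ℝ p x v) i := fun i x v => by
    rw [(hpi i x).fderiv]; rfl
  have hone : ∀ i : Fin n, ‖(EuclideanSpace.single i 1 : Euc n)‖ = 1 := fun i => by simp
  have hpci : ∀ i, Continuous fun x => p x i := fun i =>
    (EuclideanSpace.proj i : Euc n →L[ℝ] ℝ).continuous.comp hpc
  have hp'ci : ∀ i, Continuous fun x => (fderiv ℝ p x (EuclideanSpace.single i 1)) i := fun i =>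
    (EuclideanSpace.proj i : Euc n →L[ℝ] ℝ).continuous.comp (hp'.clm_apply continuous_const)
  have hf'ci : ∀ i : Fin n, Continuous fun x => fderiv ℝ f x (EuclideanSpace.single i 1) :=
    fun i => hf'.clm_apply continuous_const
  have hcoord : ∀ (v : Euc n) i, ‖v i‖ ≤ ‖v‖ := fun v i => PiLp.norm_apply_le v i
  have i1 : ∀ i, Integrable fun x => fderiv ℝ f x (EuclideanSpace.single i 1) * p x i := by
    intro i
    refine h1.mono' ((hf'ci i).mul (hpci i)).aestronglyMeasurable
      (Filter.Eventually.of_forall fun x => ?_)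
    rw [norm_mul]
    gcongr
    · simpa [hone i] using (fderiv ℝ f x).le_opNorm (EuclideanSpace.single i 1)
    · exact hcoord _ i
  have i2 : ∀ i, Integrable fun x =>
      f x * (fderiv ℝ p x (EuclideanSpace.single i 1)) i := by
    intro i
    refine h2.mono' (hfc.mul (hp'ci i)).aestronglyMeasurable
      (Filter.Eventually.of_forall fun x => ?_)
    rw [norm_mul]
    gcongr
    refine (hcoord _ i).trans ?_
    simpa [hone i] using (fderiv ℝ p x).le_opNorm (EuclideanSpace.single i 1)
  have i3 : ∀ i, Integrable fun x => f x * p x i := by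
    intro i
    refine h3.mono' (hfc.mul (hpci i)).aestronglyMeasurable
      (Filter.Eventually.of_forall fun x => ?_)
    rw [norm_mul]
    gcongr
    exact hcoord _ i
  have hsum : ∀ x, fderiv ℝ f x (p x)
      = ∑ i, fderiv ℝ f x (EuclideanSpace.single i 1) * p x i := by
    intro x
    conv_lhs => rw [← (EuclideanSpace.basisFun (Fin n) ℝ).sum_repr (p x)]
    simp [mul_comm]
  simp_rw [hsum, Finset.mul_sum]
  rw [integral_finsetSum _ fun i _ => i2 i, integral_finsetSum _ fun i _ => i1 i,
    ← Finset.sum_neg_distrib]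
  refine Finset.sum_congr rfl fun i _ => ?_
  simp_rw [← hpi']
  refine integral_mul_fderiv_eq_neg_fderiv_mul_of_integrable (i1 i) ?_ (i3 i)
    (fun x _ => hfd x) (fun x _ => (hpi i x).differentiableAt)
  simpa only [hpi'] using i2 i

theorem opA_eq_divergence {n : ℕ} (a : Matrix (Fin n) (Fin n) ℝ) {φ : Euc n → ℝ} {x : Euc n}
    (hg : Differentiable ℝ (gradient φ)) :
    opA n a φ x = -(1 / 2) * ∑ i, (fderiv ℝ (fun y => toEuclideanCLM (𝕜 := ℝ) a (gradient φ y)) x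
      (EuclideanSpace.single i 1)) i := by
  have hsp : ∀ i j, secondPartial n φ x i j
      = (fderiv ℝ (gradient φ) x (EuclideanSpace.single i 1)) j := by
    intro i j
    have h1 : (fun y => fderiv ℝ φ y (EuclideanSpace.single j 1))
        = fun y => (EuclideanSpace.proj j : Euc n →L[ℝ] ℝ) (gradient φ y) := by
      ext y
      rw [← inner_gradient_left, EuclideanSpace.inner_single_right]
      simp only [conj_trivial, one_mul, PiLp.proj_apply]
    rw [secondPartial, h1]
    exact DFunLike.congr_fun ((EuclideanSpace.proj j : Euc n →L[ℝ] ℝ).hasFDerivAt.comp x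
      (hg x).hasFDerivAt).fderiv _
  have hA : fderiv ℝ (fun y => toEuclideanCLM (𝕜 := ℝ) a (gradient φ y)) x
      = (toEuclideanCLM (𝕜 := ℝ) a : Euc n →L[ℝ] Euc n) ∘L fderiv ℝ (gradient φ) x :=
    ((toEuclideanCLM (𝕜 := ℝ) a : Euc n →L[ℝ] Euc n).hasFDerivAt.comp x
      (hg x).hasFDerivAt).fderiv
  simp only [opA, hsp, hA, ContinuousLinearMap.comp_apply, ofLp_toEuclideanCLM, mulVec, dotProduct]

/-- The estimate on a single time slice: `g` stands for the spatial gradient of the solution, `W`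
for its time derivative and `G` for the gradient of `W`. -/
theorem integral_sq_mul_piWeight_le {n : ℕ} {γ : ℝ} (hγ : (n : ℝ) / 2 + 2 < γ) {K K' : ℝ}
    (hK : 0 < K) (A : Euc n →L[ℝ] Euc n) {g G : Euc n → Euc n} {W q : Euc n → ℝ}
    (hg : ContDiff ℝ 1 g) (hG : Continuous G) (hq : Continuous q)
    (hW : ∀ x, HasGradientAt W (G x) x)
    (heq : ∀ x, W x = -(1 / 2) * ∑ i, (fderiv ℝ (fun y => A (g y)) x
      (EuclideanSpace.single i 1)) i - q x)
    (hgK : ∀ x, ‖g x‖ ≤ K * (1 + ‖x‖)) (hqK : ∀ x, |q x| ≤ K * (1 + ‖x‖ ^ 2))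
    (hK' : ∀ x, ‖fderiv ℝ g x‖ + ‖G x‖ ≤ K' * (1 + ‖x‖ ^ 2)) :
    ∫ x, W x ^ 2 * piWeight n γ x ≤ (∫ x, inner ℝ (A (g x)) (G x) * piWeight n γ x)
      + 2 * ((2 * γ * ‖A‖ * K) ^ 2 + K ^ 2) *
        ∫ x : Euc n, (1 + ‖x‖ ^ 2) ^ 2 * piWeight n γ x := by
  have hγ0 : 0 < γ := by have : (0 : ℝ) ≤ n := n.cast_nonneg; linarith
  have hgd := hg.differentiable one_ne_zero
  have hWd : Differentiable ℝ W := fun x => (hW x).differentiableAt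
  have hWc := hWd.continuous
  have hπc := continuous_piWeight n γ
  have hp : ContDiff ℝ 1 fun y => A (g y) := A.contDiff.comp hg
  have hpder : ∀ x, fderiv ℝ (fun y => A (g y)) x = A ∘L fderiv ℝ g x := fun x =>
    (A.hasFDerivAt.comp x (hgd x).hasFDerivAt).fderiv
  have hK'0 : 0 ≤ K' := by
    have h : 0 ≤ ‖fderiv ℝ g 0‖ + ‖G 0‖ := by positivity
    simpa using h.trans (hK' 0)
  have hH : ∀ x, ‖fderiv ℝ g x‖ ≤ K' * (1 + ‖x‖ ^ 2) := fun x =>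
    (le_add_of_nonneg_right (norm_nonneg _)).trans (hK' x)
  have hGb : ∀ x, ‖G x‖ ≤ K' * (1 + ‖x‖ ^ 2) := fun x =>
    (le_add_of_nonneg_left (norm_nonneg _)).trans (hK' x)
  have hDp : ∀ x, ‖fderiv ℝ (fun y => A (g y)) x‖ ≤ ‖A‖ * K' * (1 + ‖x‖ ^ 2) := fun x => by
    rw [hpder, mul_assoc]
    exact (A.opNorm_comp_le _).trans (by gcongr; exact hH x)
  have hpb : ∀ x, ‖A (g x)‖ ≤ ‖A‖ * (K * (1 + ‖x‖)) := fun x =>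
    (A.le_opNorm _).trans (by gcongr; exact hgK x)
  have hlin : ∀ x : Euc n, 1 + ‖x‖ ≤ 2 * (1 + ‖x‖ ^ 2) := fun x => by
    nlinarith [sq_nonneg (‖x‖ - 1)]
  have hpb2 : ∀ x, ‖A (g x)‖ ≤ 2 * ‖A‖ * K * (1 + ‖x‖ ^ 2) := fun x => by
    refine (hpb x).trans ?_
    have h := mul_le_mul_of_nonneg_left (hlin x) (mul_nonneg (norm_nonneg A) hK.le)
    linarith
  obtain ⟨B, hB0, hWb⟩ : ∃ B, 0 ≤ B ∧ ∀ x, |W x| ≤ B * (1 + ‖x‖ ^ 2) := by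
    refine ⟨1 / 2 * (n * (‖A‖ * K')) + K, by positivity, fun x => ?_⟩
    have hs : |∑ i, (fderiv ℝ (fun y => A (g y)) x (EuclideanSpace.single i 1)) i|
        ≤ n * (‖A‖ * K' * (1 + ‖x‖ ^ 2)) := by
      refine (Finset.abs_sum_le_sum_abs _ _).trans ?_
      refine (Finset.sum_le_card_nsmul _ _ (‖A‖ * K' * (1 + ‖x‖ ^ 2)) fun i _ => ?_).trans
        (by simp)
      refine (PiLp.norm_apply_le (fderiv ℝ (fun y => A (g y)) x
        (EuclideanSpace.single i 1)) i).trans ?_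
      refine le_trans ?_ (hDp x)
      simpa using (fderiv ℝ (fun y => A (g y)) x).le_opNorm (EuclideanSpace.single i 1)
    rw [heq x]
    have hs' := abs_le.1 hs
    have hq' := abs_le.1 (hqK x)
    rw [abs_le]
    constructor <;> linarith [hs'.1, hs'.2, hq'.1, hq'.2]
  have hDf : ∀ x, HasFDerivAt (fun y => W y * piWeight n γ y)
      (W x • ((-(2 * γ) * (piWeight n γ x / (1 + ‖x‖ ^ 2))) • innerSL ℝ x)
        + piWeight n γ x • InnerProductSpace.toDual ℝ (Euc n) (G x)) x := fun x =>
    (hW x).hasFDerivAt.mul (hasFDerivAt_piWeight n γ x)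
  have hxc : Continuous fun x : Euc n => piWeight n γ x / (1 + ‖x‖ ^ 2) :=
    hπc.div (by fun_prop) fun x => by positivity
  have hf : ContDiff ℝ 1 fun y => W y * piWeight n γ y := by
    rw [contDiff_one_iff_fderiv]
    refine ⟨fun x => (hDf x).differentiableAt, ?_⟩
    rw [funext fun x => (hDf x).fderiv]
    have := (InnerProductSpace.toDual ℝ (Euc n)).continuous.comp hG
    have h2 : Continuous fun x : Euc n => innerSL ℝ x := (innerSL ℝ).continuous
    exact (hWc.smul ((continuous_const.mul hxc).smul h2)).add (hπc.smul this)
  have hw1 : ∀ x : Euc n, 1 ≤ 1 + ‖x‖ ^ 2 := fun x => by nlinarith [sq_nonneg ‖x‖]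
  have hDfb : ∀ x, ‖fderiv ℝ (fun y => W y * piWeight n γ y) x‖
      ≤ B * (2 * γ) * ‖x‖ * piWeight n γ x + piWeight n γ x * (K' * (1 + ‖x‖ ^ 2)) := by
    intro x
    have hx : (0 : ℝ) < 1 + ‖x‖ ^ 2 := by positivity
    have hπ := piWeight_pos n γ x
    rw [(hDf x).fderiv]
    refine (norm_add_le _ _).trans (add_le_add ?_ ?_)
    · rw [norm_smul, norm_smul, innerSL_apply_norm, Real.norm_eq_abs, Real.norm_eq_abs, abs_mul,
        abs_neg, abs_of_pos (by positivity : 0 < 2 * γ), abs_of_pos (div_pos hπ hx)]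
      calc |W x| * (2 * γ * (piWeight n γ x / (1 + ‖x‖ ^ 2)) * ‖x‖)
          ≤ B * (1 + ‖x‖ ^ 2) * (2 * γ * (piWeight n γ x / (1 + ‖x‖ ^ 2)) * ‖x‖) := by
            gcongr; exact hWb x
        _ = _ := by field_simp
    · rw [norm_smul, Real.norm_eq_abs, abs_of_pos hπ, LinearIsometryEquiv.norm_map]
      gcongr
      exact hGb x
  have hprod : ∀ x : Euc n, ‖x‖ * (1 + ‖x‖) ≤ 2 * (1 + ‖x‖ ^ 2) := fun x => by
    nlinarith [sq_nonneg (‖x‖ - 1)]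
  have hxp : ∀ x : Euc n, ‖x‖ * ‖A (g x)‖ ≤ 2 * ‖A‖ * K * (1 + ‖x‖ ^ 2) := fun x => by
    have h1 := mul_le_mul_of_nonneg_left (hpb x) (norm_nonneg x)
    have h2 := mul_le_mul_of_nonneg_left (hprod x) (mul_nonneg (norm_nonneg A) hK.le)
    linarith
  have hf' := hf.continuous_fderiv one_ne_zero
  have i1 : Integrable fun x => ‖fderiv ℝ (fun y => W y * piWeight n γ y) x‖ * ‖A (g x)‖ := by
    refine integrable_of_abs_le_sq_mul_piWeight hγ (hf'.norm.mul hp.continuous.norm)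
      (C := B * (2 * γ) * (2 * ‖A‖ * K) + K' * (2 * ‖A‖ * K)) fun x => ?_
    have hπ := piWeight_pos n γ x
    rw [abs_of_nonneg (by positivity)]
    calc _ ≤ (B * (2 * γ) * ‖x‖ * piWeight n γ x + piWeight n γ x * (K' * (1 + ‖x‖ ^ 2)))
          * ‖A (g x)‖ := by gcongr; exact hDfb x
      _ = B * (2 * γ) * piWeight n γ x * (‖x‖ * ‖A (g x)‖)
          + piWeight n γ x * (K' * (1 + ‖x‖ ^ 2)) * ‖A (g x)‖ := by ring
      _ ≤ B * (2 * γ) * piWeight n γ x * (2 * ‖A‖ * K * (1 + ‖x‖ ^ 2) * (1 + ‖x‖ ^ 2))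
          + piWeight n γ x * (K' * (1 + ‖x‖ ^ 2)) * (2 * ‖A‖ * K * (1 + ‖x‖ ^ 2)) := by
        refine add_le_add (mul_le_mul_of_nonneg_left ?_ (by positivity))
          (mul_le_mul_of_nonneg_left (hpb2 x) (by positivity))
        exact (hxp x).trans (le_mul_of_one_le_right (by positivity) (hw1 x))
      _ = _ := by ring
  have i2 : Integrable fun x => ‖W x * piWeight n γ x‖ * ‖fderiv ℝ (fun y => A (g y)) x‖ := by
    refine integrable_of_abs_le_sq_mul_piWeight hγ
      ((hWc.mul hπc).norm.mul (hp.continuous_fderiv one_ne_zero).norm)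
      (C := B * (‖A‖ * K')) fun x => ?_
    have hπ := piWeight_pos n γ x
    rw [abs_of_nonneg (by positivity), norm_mul, Real.norm_eq_abs, Real.norm_eq_abs,
      abs_of_pos hπ]
    calc _ ≤ B * (1 + ‖x‖ ^ 2) * piWeight n γ x * (‖A‖ * K' * (1 + ‖x‖ ^ 2)) := by
          gcongr
          exacts [hWb x, hDp x]
      _ = _ := by ring
  have i3 : Integrable fun x => ‖W x * piWeight n γ x‖ * ‖A (g x)‖ := by
    refine integrable_of_abs_le_sq_mul_piWeight hγ ((hWc.mul hπc).norm.mul hp.continuous.norm)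
      (C := B * (2 * ‖A‖ * K)) fun x => ?_
    have hπ := piWeight_pos n γ x
    rw [abs_of_nonneg (by positivity), norm_mul, Real.norm_eq_abs, Real.norm_eq_abs,
      abs_of_pos hπ]
    calc _ ≤ B * (1 + ‖x‖ ^ 2) * piWeight n γ x * (2 * ‖A‖ * K * (1 + ‖x‖ ^ 2)) := by
          gcongr
          exacts [hWb x, hpb2 x]
      _ = _ := by ring
  have hdiv := integral_mul_divergence hf hp i1 i2 i3
  have iWW : Integrable fun x => W x ^ 2 * piWeight n γ x := by
    refine integrable_of_abs_le_sq_mul_piWeight hγ ((hWc.pow 2).mul hπc) (C := B ^ 2) fun x => ?_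
    have hπ := piWeight_pos n γ x
    rw [abs_of_nonneg (by positivity), ← mul_assoc, ← mul_pow, ← sq_abs]
    gcongr
    exact hWb x
  have iqW : Integrable fun x => q x * (W x * piWeight n γ x) := by
    refine integrable_of_abs_le_sq_mul_piWeight hγ (hq.mul (hWc.mul hπc)) (C := K * B) fun x => ?_
    have hπ := piWeight_pos n γ x
    rw [abs_mul, abs_mul, abs_of_pos hπ]
    calc _ ≤ K * (1 + ‖x‖ ^ 2) * (B * (1 + ‖x‖ ^ 2) * piWeight n γ x) := by
          gcongr
          exacts [hqK x, hWb x]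
      _ = _ := by ring
  have iD : Integrable fun x => fderiv ℝ (fun y => W y * piWeight n γ y) x (A (g x)) :=
    i1.mono' (hf'.clm_apply hp.continuous).aestronglyMeasurable
      (Filter.Eventually.of_forall fun x => ContinuousLinearMap.le_opNorm _ _)
  have iG : Integrable fun x => inner ℝ (A (g x)) (G x) * piWeight n γ x := by
    refine integrable_of_abs_le_sq_mul_piWeight hγ ((hp.continuous.inner hG).mul hπc)
      (C := 2 * ‖A‖ * K * K') fun x => ?_
    have hπ := piWeight_pos n γ x
    rw [abs_mul, abs_of_pos hπ]
    calc _ ≤ (‖A (g x)‖ * ‖G x‖) * piWeight n γ x := by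
          gcongr; exact abs_real_inner_le_norm _ _
      _ ≤ (2 * ‖A‖ * K * (1 + ‖x‖ ^ 2) * (K' * (1 + ‖x‖ ^ 2))) * piWeight n γ x := by
          gcongr
          exacts [hpb2 x, hGb x]
      _ = _ := by ring
  have hkey : ∫ x, W x ^ 2 * piWeight n γ x
      = ∫ x, (1 / 2 * fderiv ℝ (fun y => W y * piWeight n γ y) x (A (g x))
        - q x * (W x * piWeight n γ x)) := by
    have h1 : ∀ x, W x ^ 2 * piWeight n γ x = -(1 / 2) * (W x * piWeight n γ x *
        ∑ i, (fderiv ℝ (fun y => A (g y)) x (EuclideanSpace.single i 1)) i)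
        - q x * (W x * piWeight n γ x) := by
      intro x
      rw [sq]
      nth_rewrite 1 [heq x]
      ring
    have i4 : Integrable fun x => W x * piWeight n γ x *
        ∑ i, (fderiv ℝ (fun y => A (g y)) x (EuclideanSpace.single i 1)) i := by
      have := (iWW.add iqW).const_mul (-2)
      refine this.congr (Filter.Eventually.of_forall fun x => ?_)
      simp only [Pi.add_apply, h1]
      ring
    rw [integral_congr_ae (Filter.Eventually.of_forall h1),
      integral_sub (i4.const_mul _) iqW, integral_sub (iD.const_mul _) iqW, integral_const_mul,
      integral_const_mul, hdiv]
    ring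
  have hpt : ∀ x, 1 / 2 * fderiv ℝ (fun y => W y * piWeight n γ y) x (A (g x))
        - q x * (W x * piWeight n γ x)
      ≤ 1 / 2 * (inner ℝ (A (g x)) (G x) * piWeight n γ x) + 1 / 2 * (W x ^ 2 * piWeight n γ x)
        + ((2 * γ * ‖A‖ * K) ^ 2 + K ^ 2) * ((1 + ‖x‖ ^ 2) ^ 2 * piWeight n γ x) := by
    intro x
    have hπ := piWeight_pos n γ x
    have hx : (0 : ℝ) < 1 + ‖x‖ ^ 2 := by positivity
    obtain ⟨c, hc, hcb⟩ : ∃ c, inner ℝ x (A (g x)) = c * (1 + ‖x‖ ^ 2) ∧ |c| ≤ 2 * ‖A‖ * K := by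
      refine ⟨inner ℝ x (A (g x)) / (1 + ‖x‖ ^ 2), by field_simp, ?_⟩
      rw [abs_div, abs_of_pos hx, div_le_iff₀ hx]
      exact (abs_real_inner_le_norm _ _).trans (hxp x)
    have hval : fderiv ℝ (fun y => W y * piWeight n γ y) x (A (g x))
        = -(2 * γ) * c * W x * piWeight n γ x
          + inner ℝ (A (g x)) (G x) * piWeight n γ x := by
      rw [(hDf x).fderiv]
      simp only [_root_.add_apply, _root_.smul_apply, smul_eq_mul,
        innerSL_apply_apply, InnerProductSpace.toDual_apply_apply, hc,
        real_inner_comm (A (g x)) (G x)]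
      field_simp
    have hc2 : c ^ 2 ≤ (2 * ‖A‖ * K) ^ 2 := sq_le_sq' (abs_le.1 hcb).1 (abs_le.1 hcb).2
    have hq2 : q x ^ 2 ≤ K ^ 2 * (1 + ‖x‖ ^ 2) ^ 2 := by
      rw [← mul_pow]
      exact sq_le_sq' (abs_le.1 (hqK x)).1 (abs_le.1 (hqK x)).2
    have hscal : -(γ * c * W x) - q x * W x
        ≤ 1 / 2 * W x ^ 2 + ((2 * γ * ‖A‖ * K) ^ 2 + K ^ 2) * (1 + ‖x‖ ^ 2) ^ 2 := by
      have e1 : (γ * c) ^ 2 ≤ (2 * γ * ‖A‖ * K) ^ 2 * (1 + ‖x‖ ^ 2) ^ 2 := by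
        calc (γ * c) ^ 2 = γ ^ 2 * c ^ 2 := by ring
          _ ≤ γ ^ 2 * (2 * ‖A‖ * K) ^ 2 := by gcongr
          _ = (2 * γ * ‖A‖ * K) ^ 2 := by ring
          _ ≤ _ := le_mul_of_one_le_right (sq_nonneg _) (one_le_pow₀ (hw1 x))
      nlinarith [sq_nonneg (γ * c + W x / 2), sq_nonneg (q x + W x / 2)]
    have := mul_le_mul_of_nonneg_right hscal hπ.le
    rw [hval]
    linarith
  have hJ := integrable_sq_mul_piWeight hγ
  have iS : Integrable fun x => 1 / 2 * (inner ℝ (A (g x)) (G x) * piWeight n γ x)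
      + 1 / 2 * (W x ^ 2 * piWeight n γ x) := (iG.const_mul _).add (iWW.const_mul _)
  have iR : Integrable fun x => 1 / 2 * fderiv ℝ (fun y => W y * piWeight n γ y) x (A (g x))
      - q x * (W x * piWeight n γ x) := (iD.const_mul _).sub iqW
  have hmono := integral_mono iR
    (iS.add (hJ.const_mul ((2 * γ * ‖A‖ * K) ^ 2 + K ^ 2))) hpt
  simp only [Pi.add_apply] at hmono
  rw [← hkey, integral_add iS (hJ.const_mul _),
    integral_add (iG.const_mul _) (iWW.const_mul _), integral_const_mul, integral_const_mul,
    integral_const_mul] at hmono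
  linarith

/-- By the fundamental theorem of calculus in time and Fubini, the space-time integral of
`⟪A g, ∂ₛg⟫ π` is controlled by the growth of `g` alone. -/
theorem integral_inner_mul_piWeight_le {n : ℕ} {γ : ℝ} (hγ : (n : ℝ) / 2 + 2 < γ) {K K' : ℝ}
    {A : Euc n →L[ℝ] Euc n} (hsymm : ∀ x y, inner ℝ (A x) y = inner ℝ x (A y))
    (hpos : ∀ x, 0 ≤ inner ℝ (A x) x) {t T : ℝ} (htT : t ≤ T) {g G : ℝ → Euc n → Euc n}
    (hder : ∀ x, ∀ s ∈ Set.Icc t T, HasDerivAt (fun r => g r x) (G s x) s)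
    (hgc : ContinuousOn (fun p : ℝ × Euc n => g p.1 p.2) (Set.Icc t T ×ˢ Set.univ))
    (hGc : ContinuousOn (fun p : ℝ × Euc n => G p.1 p.2) (Set.Icc t T ×ˢ Set.univ))
    (hgK : ∀ s ∈ Set.Icc t T, ∀ x, ‖g s x‖ ≤ K * (1 + ‖x‖))
    (hGK : ∀ s ∈ Set.Icc t T, ∀ x, ‖G s x‖ ≤ K' * (1 + ‖x‖ ^ 2)) :
    IntervalIntegrable (fun s => ∫ x, inner ℝ (A (g s x)) (G s x) * piWeight n γ x) volume t T ∧
      ∫ s in t..T, ∫ x, inner ℝ (A (g s x)) (G s x) * piWeight n γ x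
        ≤ ‖A‖ * K ^ 2 * ∫ x : Euc n, (1 + ‖x‖ ^ 2) ^ 2 * piWeight n γ x := by
  have hπc := continuous_piWeight n γ
  have hJ := integrable_sq_mul_piWeight hγ
  have hFc : ContinuousOn (fun p : ℝ × Euc n => inner ℝ (A (g p.1 p.2)) (G p.1 p.2))
      (Set.Icc t T ×ˢ Set.univ) := (A.continuous.comp_continuousOn hgc).inner hGc
  have hAg : ∀ s ∈ Set.Icc t T, ∀ x, inner ℝ (A (g s x)) (g s x)
      ≤ 2 * (‖A‖ * K ^ 2 * (1 + ‖x‖ ^ 2) ^ 2) := by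
    intro s hs x
    have h1 : (1 + ‖x‖) ^ 2 ≤ 2 * (1 + ‖x‖ ^ 2) ^ 2 := by
      nlinarith [sq_nonneg (‖x‖ - 1), sq_nonneg (‖x‖ ^ 2)]
    calc inner ℝ (A (g s x)) (g s x) ≤ ‖A (g s x)‖ * ‖g s x‖ := real_inner_le_norm _ _
      _ ≤ ‖A‖ * ‖g s x‖ * ‖g s x‖ := by gcongr; exact A.le_opNorm _
      _ = ‖A‖ * ‖g s x‖ ^ 2 := by ring
      _ ≤ ‖A‖ * (K * (1 + ‖x‖)) ^ 2 := by gcongr; exact hgK s hs x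
      _ = ‖A‖ * K ^ 2 * (1 + ‖x‖) ^ 2 := by ring
      _ ≤ ‖A‖ * K ^ 2 * (2 * (1 + ‖x‖ ^ 2) ^ 2) := by gcongr
      _ = _ := by ring
  have hFint : Integrable (Function.uncurry fun s x =>
      inner ℝ (A (g s x)) (G s x) * piWeight n γ x)
      ((volume.restrict (Set.uIoc t T)).prod volume) := by
    have : IsFiniteMeasure (volume.restrict (Set.uIoc t T)) :=
      ⟨by rw [Measure.restrict_apply_univ, Set.uIoc_of_le htT]; exact measure_Ioc_lt_top⟩
    have hmeas : (volume.restrict (Set.uIoc t T)).prod (volume : Measure (Euc n))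
        = (volume : Measure (ℝ × Euc n)).restrict (Set.Ioc t T ×ˢ Set.univ) := by
      rw [Set.uIoc_of_le htT, Measure.volume_eq_prod, ← Measure.prod_restrict,
        Measure.restrict_univ]
    refine ((hJ.const_mul (‖A‖ * (2 * K) * K')).comp_snd _).mono' ?_ ?_
    · rw [hmeas]
      refine (ContinuousOn.mono ?_ (Set.prod_mono Set.Ioc_subset_Icc_self
        le_rfl)).aestronglyMeasurable (measurableSet_Ioc.prod MeasurableSet.univ)
      exact hFc.mul (hπc.comp continuous_snd).continuousOn
    · rw [hmeas]
      filter_upwards [ae_restrict_mem (measurableSet_Ioc.prod MeasurableSet.univ)] with p hp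
      have hs := Set.Ioc_subset_Icc_self hp.1
      have hπ := piWeight_pos n γ p.2
      have h1 : ‖g p.1 p.2‖ ≤ 2 * K * (1 + ‖p.2‖ ^ 2) := by
        have h2 := hgK _ hs p.2
        have hp0 : (0 : ℝ) < 1 + ‖p.2‖ := by positivity
        have hK : 0 ≤ K := nonneg_of_mul_nonneg_left ((norm_nonneg _).trans h2) hp0
        nlinarith [mul_nonneg hK (sq_nonneg (‖p.2‖ - 1)), mul_nonneg hK (sq_nonneg ‖p.2‖)]
      simp only [Function.uncurry, norm_mul, Real.norm_eq_abs, abs_of_pos hπ]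
      calc _ ≤ ‖A (g p.1 p.2)‖ * ‖G p.1 p.2‖ * piWeight n γ p.2 := by
            gcongr; exact abs_real_inner_le_norm _ _
        _ ≤ ‖A‖ * ‖g p.1 p.2‖ * ‖G p.1 p.2‖ * piWeight n γ p.2 := by
            gcongr; exact A.le_opNorm _
        _ ≤ ‖A‖ * (2 * K * (1 + ‖p.2‖ ^ 2)) * (K' * (1 + ‖p.2‖ ^ 2)) * piWeight n γ p.2 := by
            have := (norm_nonneg _).trans h1
            gcongr
            exact hGK _ hs _
        _ = _ := by ring
  refine ⟨?_, ?_⟩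
  · rw [intervalIntegrable_iff]
    exact hFint.integral_prod_left
  · have hinner : ∀ x, ∫ s in t..T, inner ℝ (A (g s x)) (G s x) * piWeight n γ x
        ≤ ‖A‖ * K ^ 2 * ((1 + ‖x‖ ^ 2) ^ 2 * piWeight n γ x) := by
      intro x
      have hFTC : ∫ s in t..T, inner ℝ (A (g s x)) (G s x)
          = 1 / 2 * inner ℝ (A (g T x)) (g T x) - 1 / 2 * inner ℝ (A (g t x)) (g t x) := by
        refine intervalIntegral.integral_eq_sub_of_hasDerivAt
          (f := fun s => 1 / 2 * inner ℝ (A (g s x)) (g s x)) (fun s hs => ?_) ?_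
        · rw [Set.uIcc_of_le htT] at hs
          have hd := hder x s hs
          have hAd : HasDerivAt (fun r => A (g r x)) (A (G s x)) s :=
            A.hasFDerivAt.comp_hasDerivAt s hd
          refine ((hAd.inner ℝ hd).const_mul (1 / 2 : ℝ)).congr_deriv ?_
          rw [hsymm (G s x), real_inner_comm (A (g s x)) (G s x)]
          ring
        · refine ContinuousOn.intervalIntegrable ?_
          rw [Set.uIcc_of_le htT]
          exact hFc.comp (f := fun s => (s, x)) (by fun_prop) fun s hs => ⟨hs, Set.mem_univ _⟩
      rw [intervalIntegral.integral_mul_const, hFTC, ← mul_assoc]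
      refine mul_le_mul_of_nonneg_right ?_ (piWeight_pos n γ x).le
      linarith [hAg T (Set.right_mem_Icc.2 htT) x, hpos (g t x)]
    rw [intervalIntegral_integral_swap hFint, ← integral_const_mul]
    refine integral_mono ?_ (hJ.const_mul _) hinner
    have := hFint.integral_prod_right
    simpa only [intervalIntegral.integral_of_le htT, Set.uIoc_of_le htT, Function.uncurry] using this

theorem inner_toEuclideanCLM_left {n : ℕ} (B : Matrix (Fin n) (Fin n) ℝ) (x y : Euc n) :
    inner ℝ (toEuclideanCLM (𝕜 := ℝ) B x) y = inner ℝ x (toEuclideanCLM (𝕜 := ℝ) Bᵀ y) := by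
  rw [real_inner_comm, inner_toEuclideanCLM, inner_toEuclideanCLM, dotProduct_mulVec,
    ← mulVec_transpose, dotProduct_comm]

theorem inner_toEuclideanCLM_mul_transpose_self {n : ℕ} (B : Matrix (Fin n) (Fin n) ℝ)
    (x : Euc n) : 0 ≤ inner ℝ (toEuclideanCLM (𝕜 := ℝ) (B * Bᵀ) x) x := by
  rw [map_mul, mul_apply_eq_comp, inner_toEuclideanCLM_left]
  exact real_inner_self_nonneg

/-- **Proposition 5.4.** Weighted energy estimate for the time derivative of a
solution of `−∂_s V + 𝒜V = Q`, `V(T,·) = Q_T`: the constant `C` depends only on `K`, `γ`,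
`n`, the matrix `a` and `T − t`, and not on `K′` or otherwise on `V`. -/
theorem time_derivative_energy_estimate
    (n : ℕ) (hn : 1 ≤ n) (σM : Matrix (Fin n) (Fin n) ℝ) (hσ : IsUnit σM.det)
    (a : Matrix (Fin n) (Fin n) ℝ) (ha : a = σM * σMᵀ)
    (t T K γ : ℝ) (htT : t < T) (hK : 0 < K) (hγ : (n : ℝ) / 2 + 2 < γ) :
    ∃ C > (0 : ℝ), ∀ (Q : ℝ → Euc n → ℝ) (QT : Euc n → ℝ) (V : ℝ → Euc n → ℝ),
      -- Q continuous with quadratic growth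
      ContinuousOn (fun p : ℝ × Euc n => Q p.1 p.2) (Set.Icc t T ×ˢ Set.univ) →
      (∀ s ∈ Set.Icc t T, ∀ x : Euc n, |Q s x| ≤ K * (1 + ‖x‖ ^ 2)) →
      -- Q_T continuously differentiable with linearly growing gradient
      ContDiff ℝ 1 QT →
      (∀ x : Euc n, ‖gradient QT x‖ ≤ K * (1 + ‖x‖)) →
      -- existence and continuity of ∂_sV, DV, D²V and ∂_sDV on [t,T]×ℝⁿ
      (∀ x : Euc n, ∀ s ∈ Set.Icc t T, DifferentiableAt ℝ (fun σ' => V σ' x) s) →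
      (∀ s ∈ Set.Icc t T, ContDiff ℝ 2 (V s)) →
      ContinuousOn (fun p : ℝ × Euc n => deriv (fun σ' => V σ' p.2) p.1)
        (Set.Icc t T ×ˢ Set.univ) →
      ContinuousOn (fun p : ℝ × Euc n => gradient (V p.1) p.2) (Set.Icc t T ×ˢ Set.univ) →
      ContinuousOn (fun p : ℝ × Euc n => fderiv ℝ (gradient (V p.1)) p.2)
        (Set.Icc t T ×ˢ Set.univ) →
      (∀ x : Euc n, ∀ s ∈ Set.Icc t T, DifferentiableAt ℝ (fun σ' => gradient (V σ') x) s) →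
      ContinuousOn (fun p : ℝ × Euc n => deriv (fun σ' => gradient (V σ') p.2) p.1)
        (Set.Icc t T ×ˢ Set.univ) →
      -- V solves the equation with terminal data Q_T
      (∀ s ∈ Set.Ico t T, ∀ x : Euc n,
        -(deriv (fun σ' => V σ' x) s) + opA n a (V s) x = Q s x) →
      (∀ x : Euc n, V T x = QT x) →
      -- linear growth of the gradient
      (∀ s ∈ Set.Icc t T, ∀ x : Euc n, ‖gradient (V s) x‖ ≤ K * (1 + ‖x‖)) →
      -- the auxiliary bound with some K′ (only to justify integrations by parts)
      (∃ K' > (0 : ℝ), ∀ s ∈ Set.Icc t T, ∀ x : Euc n,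
        ‖fderiv ℝ (gradient (V s)) x‖ + ‖deriv (fun σ' => gradient (V σ') x) s‖
          ≤ K' * (1 + ‖x‖ ^ 2)) →
      -- conclusion
      (∫ s in t..T, ∫ x : Euc n,
        (deriv (fun σ' => V σ' x) s) ^ 2 * piWeight n γ x) ≤ C := by
  set A : Euc n →L[ℝ] Euc n := toEuclideanCLM (𝕜 := ℝ) a with hA
  set J := ∫ x : Euc n, (1 + ‖x‖ ^ 2) ^ 2 * piWeight n γ x
  set M := 2 * ((2 * γ * ‖A‖ * K) ^ 2 + K ^ 2) * J
  have hJ0 : 0 ≤ J := integral_nonneg fun x =>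
    mul_nonneg (by positivity) (piWeight_pos n γ x).le
  have hM0 : 0 ≤ M := by positivity
  have hTt : 0 < T - t := sub_pos.2 htT
  refine ⟨‖A‖ * K ^ 2 * J + (T - t) * M + 1, by positivity, ?_⟩
  intro Q QT V hQc hQK _ _ hVs hVx _ hgc _ hgs hGc hpde _ hgK ⟨K', _, hK'⟩
  have hslice : ∀ {F : Type} [TopologicalSpace F] {f : ℝ × Euc n → F},
      ContinuousOn f (Set.Icc t T ×ˢ Set.univ) → ∀ s ∈ Set.Icc t T,
      Continuous fun x => f (s, x) := fun hf s hs =>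
    hf.comp_continuous (by fun_prop) fun x => ⟨hs, Set.mem_univ _⟩
  obtain ⟨hint, hle⟩ := integral_inner_mul_piWeight_le hγ (A := A) (K := K) (K' := K')
    (fun x y => by
      rw [inner_toEuclideanCLM_left, ha, transpose_mul, transpose_transpose, ← ha])
    (fun x => by rw [hA, ha]; exact inner_toEuclideanCLM_mul_transpose_self σM x) htT.le
    (g := fun s => gradient (V s)) (G := fun s x => deriv (fun r => gradient (V r) x) s)
    (fun x s hs => (hgs x s hs).hasDerivAt) hgc hGc hgK
    (fun s hs x => (le_add_of_nonneg_left (norm_nonneg _)).trans (hK' s hs x))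
  have hts : ∀ s ∈ Set.Ioo t T, ∫ x, deriv (fun r => V r x) s ^ 2 * piWeight n γ x
      ≤ (∫ x, inner ℝ (A (gradient (V s) x)) (deriv (fun r => gradient (V r) x) s)
        * piWeight n γ x) + M := by
    intro s hs
    have hsI := Set.Ioo_subset_Icc_self hs
    have hgrad : ContDiff ℝ 1 (gradient (V s)) :=
      (InnerProductSpace.toDual ℝ (Euc n)).symm.contDiff.comp
        ((hVx s hsI).fderiv_right (m := 1) (by norm_num))
    refine integral_sq_mul_piWeight_le hγ hK A (q := Q s) (K' := K') hgrad (hslice hGc s hsI)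
      (hslice hQc s hsI)
      (hasGradientAt_deriv_of_continuousOn_deriv_gradient (Set.Ioo_subset_Ico_self hs)
        (fun x => hVs x s hsI) (fun r hr => (hVx r hr).differentiable two_ne_zero) hgs hGc)
      (fun x => ?_) (hgK s hsI) (hQK s hsI) (hK' s hsI)
    rw [← opA_eq_divergence a (hgrad.differentiable one_ne_zero)]
    linarith [hpde s (Set.Ioo_subset_Ico_self hs) x]
  have hmono : ∫ s in t..T, ∫ x, deriv (fun r => V r x) s ^ 2 * piWeight n γ x
      ≤ ∫ s in t..T, ((∫ x, inner ℝ (A (gradient (V s) x))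
        (deriv (fun r => gradient (V r) x) s) * piWeight n γ x) + M) := by
    rw [intervalIntegral.integral_of_le htT.le, intervalIntegral.integral_of_le htT.le,
      integral_Ioc_eq_integral_Ioo, integral_Ioc_eq_integral_Ioo]
    refine integral_mono_of_nonneg (Filter.Eventually.of_forall fun s => integral_nonneg
      fun x => mul_nonneg (sq_nonneg _) (piWeight_pos n γ x).le) ?_ ?_
    · exact ((intervalIntegrable_iff_integrableOn_Ioo_of_le htT.le).1
        (hint.add intervalIntegrable_const))
    · filter_upwards [ae_restrict_mem measurableSet_Ioo] with s hs using hts s hs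
  rw [intervalIntegral.integral_add hint intervalIntegrable_const,
    intervalIntegral.integral_const, smul_eq_mul] at hmono
  linarith

end
end

section
/- (Theorem 5.1, interior Hölder estimate for the linear parabolic equation.) Let t < T and K > 0. Let g : [t,T]×ℝⁿ → ℝⁿ and l : [t,T]×ℝⁿ → ℝ be continuous and l_T : ℝⁿ → ℝ continuously differentiable, with |g(s,x)| ≤ K(1+|x|), |l(s,x)| ≤ K(1+|x|²), |l_T(x)| ≤ K(1+|x|²) and |Dl_T(x)| ≤ K(1+|x|). Let J : [t,T]×ℝⁿ → ℝ be continuous, C¹ in s and C² in x on [t,T)×ℝⁿ, solve −∂_s J + 𝒜J − g·DJ = l on [t,T)×ℝⁿ with J(T,·) = l_T, and satisfy |J(s,x)| ≤ K(1+|x|²). Then for every bounded open set O ⊂ ℝⁿ there exist δ₀ ∈ (0, 1/2) and C > 0, depending only on the closure of O, T−t, n, the matrix a and K (not otherwise on J, g, l, l_T), such that |J(s₁,x₁) − J(s₂,x₂)| ≤ C·(|x₁−x₂|^{2δ₀} + |s₁−s₂|^{δ₀}) for all x₁, x₂ in the closure of O and all s₁, s₂ ∈ [t,T]. -/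
open Real MeasureTheory Matrix
open scoped RealInnerProductSpace

noncomputable section

section Calculus

open Filter Topology InnerProductSpace

theorem HasDerivAt.nonpos_of_eventually_le {f : ℝ → ℝ} {f' x : ℝ} (hf : HasDerivAt f f' x)
    (h : ∀ᶠ y in 𝓝[>] x, f y ≤ f x) : f' ≤ 0 := by
  have hs := hf.tendsto_slope.mono_left (nhdsGT_le_nhdsNE x)
  refine le_of_tendsto hs ?_
  filter_upwards [h, self_mem_nhdsWithin] with y hy hxy
  rw [slope_def_field]
  exact div_nonpos_of_nonpos_of_nonneg (sub_nonpos.2 hy) (sub_nonneg.2 (le_of_lt hxy))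

theorem IsLocalMax.second_deriv_nonpos {f f' : ℝ → ℝ} {f'' x : ℝ} (hmax : IsLocalMax f x)
    (hf : ∀ᶠ y in 𝓝 x, HasDerivAt f (f' y) y) (hf' : HasDerivAt f' f'' x) : f'' ≤ 0 := by
  by_contra! hpos
  have hd : deriv f =ᶠ[𝓝 x] f' := hf.mono fun y hy => hy.deriv
  have hdd : deriv (deriv f) x = f'' := hd.deriv_eq.trans hf'.deriv
  have hmin : IsLocalMin f x :=
    isLocalMin_of_deriv_deriv_pos (hdd ▸ hpos) hmax.deriv_eq_zero hf.self_of_nhds.continuousAt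
  have hconst : f =ᶠ[𝓝 x] fun _ => f x := by
    filter_upwards [hmax, hmin] with y h₁ h₂ using le_antisymm h₁ h₂
  have hzero : deriv (deriv f) x = 0 := by
    rw [hconst.deriv.deriv_eq]
    simp
  linarith

variable {E : Type*} [NormedAddCommGroup E] [InnerProductSpace ℝ E]

theorem hasDerivAt_comp_line {u : E → ℝ} (hu : Differentiable ℝ u) (x α : E) (h : ℝ) :
    HasDerivAt (fun h : ℝ => u (x + h • α)) (fderiv ℝ u (x + h • α) α) h := by
  have hl : HasDerivAt (fun h : ℝ => x + h • α) α h := by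
    simpa using ((hasDerivAt_id h).smul_const α).const_add x
  exact (hu (x + h • α)).hasFDerivAt.comp_hasDerivAt h hl

theorem hasDerivAt_fderiv_comp_line {u : E → ℝ} (hu : ContDiff ℝ 2 u) (x α : E) :
    HasDerivAt (fun h : ℝ => fderiv ℝ u (x + h • α) α) (iteratedFDeriv ℝ 2 u x ![α, α]) 0 := by
  have hd : Differentiable ℝ (fderiv ℝ u) :=
    (hu.fderiv_right (m := 1) (by norm_num)).differentiable (by norm_num)
  have hl : HasDerivAt (fun h : ℝ => x + h • α) α 0 := by
    simpa using ((hasDerivAt_id (0 : ℝ)).smul_const α).const_add x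
  have h0 : HasFDerivAt (fderiv ℝ u) (fderiv ℝ (fderiv ℝ u) x) (x + (0 : ℝ) • α) := by
    simpa using (hd x).hasFDerivAt
  have h1 : HasDerivAt (fun h : ℝ => fderiv ℝ u (x + h • α)) (fderiv ℝ (fderiv ℝ u) x α) 0 :=
    h0.comp_hasDerivAt (0 : ℝ) hl
  have h2 := h1.clm_apply (hasDerivAt_const (0 : ℝ) α)
  refine h2.congr_deriv ?_
  rw [iteratedFDeriv_two_apply, map_zero, add_zero]
  rfl

theorem norm_add_smul_sub_sq (x α z₀ : E) (h : ℝ) :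
    ‖x + h • α - z₀‖ ^ 2 = ‖x - z₀‖ ^ 2 + 2 * inner ℝ (x - z₀) α * h + ‖α‖ ^ 2 * h ^ 2 := by
  rw [add_sub_right_comm, norm_add_sq_real, inner_smul_right, norm_smul, mul_pow,
    Real.norm_eq_abs, sq_abs]
  ring

theorem hasDerivAt_norm_add_smul_sub_sq (x α z₀ : E) (h : ℝ) :
    HasDerivAt (fun h : ℝ => ‖x + h • α - z₀‖ ^ 2)
      (2 * inner ℝ (x - z₀) α + ‖α‖ ^ 2 * (2 * h)) h := by
  simp_rw [norm_add_smul_sub_sq]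
  have := (((hasDerivAt_id' h).const_mul (2 * inner ℝ (x - z₀) α)).const_add
    (‖x - z₀‖ ^ 2)).fun_add ((hasDerivAt_pow 2 h).const_mul (‖α‖ ^ 2))
  refine this.congr_deriv ?_
  norm_num

/-- The function whose nonpositivity expresses a Lipschitz bound, localised around `z₀`. -/
def doubling (A B κ : ℝ) (z₀ : E) (u w : E → ℝ) (p : E × E) : ℝ :=
  u p.1 - w p.2 - A * (1 - Real.exp (-κ * ‖p.1 - p.2‖)) - B * (‖p.1 - z₀‖ ^ 2 + ‖p.2 - z₀‖ ^ 2)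

variable {A B κ : ℝ} {z₀ x y : E} {u w : E → ℝ}

theorem isLocalMax_doubling_line (hmax : IsLocalMax (doubling A B κ z₀ u w) (x, y)) (α β : E) :
    IsLocalMax (fun h : ℝ => doubling A B κ z₀ u w (x + h • α, y + h • β)) 0 := by
  have hc : ContinuousAt (fun h : ℝ => (x + h • α, y + h • β)) 0 := by fun_prop
  have h0 : (fun h : ℝ => (x + h • α, y + h • β)) 0 = (x, y) := by simp
  exact IsLocalMax.comp_continuous (b := (0 : ℝ)) (h0 ▸ hmax) hc

theorem fderiv_sub_fderiv_le_of_isLocalMax_doubling (hA : 0 ≤ A) (hκ : 0 ≤ κ)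
    (hu : Differentiable ℝ u) (hw : Differentiable ℝ w)
    (hmax : IsLocalMax (doubling A B κ z₀ u w) (x, y)) (α β : E) :
    fderiv ℝ u x α - fderiv ℝ w y β ≤ A * κ * Real.exp (-κ * ‖x - y‖) * ‖α - β‖
      + 2 * B * (inner ℝ (x - z₀) α + inner ℝ (y - z₀) β) := by
  set r := ‖x - y‖
  set f : ℝ → ℝ := fun h => u (x + h • α) - w (y + h • β)
    - A * (1 - Real.exp (-κ * (r + h * ‖α - β‖)))
    - B * (‖x + h • α - z₀‖ ^ 2 + ‖y + h • β - z₀‖ ^ 2)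
  have hexp : HasDerivAt (fun h : ℝ => A * (1 - Real.exp (-κ * (r + h * ‖α - β‖))))
      (A * κ * Real.exp (-κ * r) * ‖α - β‖) 0 := by
    have h1 : HasDerivAt (fun h : ℝ => -κ * (r + h * ‖α - β‖)) (-κ * ‖α - β‖) 0 := by
      simpa using (((hasDerivAt_id (0 : ℝ)).mul_const ‖α - β‖).const_add r).const_mul (-κ)
    refine ((h1.exp.const_sub 1).const_mul A).congr_deriv ?_
    rw [zero_mul, add_zero]
    ring
  have hf := (((hasDerivAt_comp_line hu x α 0).sub (hasDerivAt_comp_line hw y β 0)).sub hexp).sub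
    (((hasDerivAt_norm_add_smul_sub_sq x α z₀ 0).add
      (hasDerivAt_norm_add_smul_sub_sq y β z₀ 0)).const_mul B)
  have hle := HasDerivAt.nonpos_of_eventually_le (f := f) hf ?_
  · simp only [zero_smul, add_zero, mul_zero] at hle
    linarith
  · filter_upwards [(isLocalMax_doubling_line hmax α β).filter_mono nhdsWithin_le_nhds,
      self_mem_nhdsWithin] with h hh hpos
    have hpos' : (0 : ℝ) < h := hpos
    have hr : ‖x + h • α - (y + h • β)‖ ≤ r + h * ‖α - β‖ := by
      calc ‖x + h • α - (y + h • β)‖ = ‖(x - y) + h • (α - β)‖ := by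
            congr 1; rw [smul_sub]; abel
        _ ≤ r + ‖h • (α - β)‖ := norm_add_le _ _
        _ = _ := by rw [norm_smul, Real.norm_of_nonneg hpos'.le]
    have he : Real.exp (-κ * (r + h * ‖α - β‖)) ≤ Real.exp (-κ * ‖x + h • α - (y + h • β)‖) :=
      Real.exp_le_exp.2 (by nlinarith)
    have := mul_le_mul_of_nonneg_left he hA
    simp only [doubling, zero_smul, add_zero] at hh
    simp only [f, zero_smul, add_zero, zero_mul]
    linarith

theorem iteratedFDeriv_two_sub_le_of_isLocalMax_doubling
    (hu : ContDiff ℝ 2 u) (hw : ContDiff ℝ 2 w)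
    (hmax : IsLocalMax (doubling A B κ z₀ u w) (x, y)) {α β : E} {c : ℝ}
    (hc : ∀ᶠ h : ℝ in 𝓝 0, ‖x + h • α - (y + h • β)‖ = ‖x - y‖ + c * h) :
    iteratedFDeriv ℝ 2 u x ![α, α] - iteratedFDeriv ℝ 2 w y ![β, β] ≤
      -(A * κ ^ 2 * c ^ 2 * Real.exp (-κ * ‖x - y‖)) + 2 * B * (‖α‖ ^ 2 + ‖β‖ ^ 2) := by
  set r := ‖x - y‖
  set f : ℝ → ℝ := fun h => u (x + h • α) - w (y + h • β)
    - A * (1 - Real.exp (-κ * (r + c * h)))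
    - B * (‖x + h • α - z₀‖ ^ 2 + ‖y + h • β - z₀‖ ^ 2) with hfdef
  have hlin : ∀ h : ℝ, HasDerivAt (fun h : ℝ => -κ * (r + c * h)) (-κ * c) h := fun h => by
    simpa using (((hasDerivAt_id h).const_mul c).const_add r).const_mul (-κ)
  have hf : ∀ h : ℝ, HasDerivAt f (fderiv ℝ u (x + h • α) α - fderiv ℝ w (y + h • β) β
      - A * (κ * c) * Real.exp (-κ * (r + c * h))
      - B * ((2 * inner ℝ (x - z₀) α + ‖α‖ ^ 2 * (2 * h))
        + (2 * inner ℝ (y - z₀) β + ‖β‖ ^ 2 * (2 * h)))) h := fun h => by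
    have := (((hasDerivAt_comp_line (hu.differentiable (by norm_num)) x α h).sub
      (hasDerivAt_comp_line (hw.differentiable (by norm_num)) y β h)).sub
      (((hlin h).exp.const_sub 1).const_mul A)).sub
      (((hasDerivAt_norm_add_smul_sub_sq x α z₀ h).add
        (hasDerivAt_norm_add_smul_sub_sq y β z₀ h)).const_mul B)
    refine this.congr_deriv ?_
    ring
  have hq : ∀ a b : ℝ, HasDerivAt (fun h : ℝ => a + b * (2 * h)) (b * 2) 0 := fun a b => by
    simpa using (((hasDerivAt_id (0 : ℝ)).const_mul 2).const_mul b).const_add a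
  have hf' := (((hasDerivAt_fderiv_comp_line hu x α).sub (hasDerivAt_fderiv_comp_line hw y β)).sub
    ((hlin 0).exp.const_mul (A * (κ * c)))).sub
    (((hq (2 * inner ℝ (x - z₀) α) (‖α‖ ^ 2)).add
      (hq (2 * inner ℝ (y - z₀) β) (‖β‖ ^ 2))).const_mul B)
  have hfmax : IsLocalMax f 0 := by
    refine (isLocalMax_doubling_line hmax α β).congr ?_
    filter_upwards [hc] with h hh
    simp only [doubling, hfdef, hh]
  have := hfmax.second_deriv_nonpos (.of_forall hf) hf'
  simp only [mul_zero, add_zero] at this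
  linarith

theorem laplacian_sub_le_of_isLocalMax_doubling [FiniteDimensional ℝ E]
    (hu : ContDiff ℝ 2 u) (hw : ContDiff ℝ 2 w) (hxy : x ≠ y)
    (hmax : IsLocalMax (doubling A B κ z₀ u w) (x, y)) :
    Laplacian.laplacian u x - Laplacian.laplacian w y ≤
      -(4 * A * κ ^ 2 * Real.exp (-κ * ‖x - y‖)) + 4 * B * Module.finrank ℝ E := by
  classical
  have hr : 0 < ‖x - y‖ := norm_pos_iff.2 (sub_ne_zero.2 hxy)
  set e : E := ‖x - y‖⁻¹ • (x - y) with he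
  have hre : x - y = ‖x - y‖ • e := by rw [he, smul_inv_smul₀ hr.ne']
  have hne : ‖e‖ = 1 := by rw [he, norm_smul, norm_inv, norm_norm, inv_mul_cancel₀ hr.ne']
  have hon : Orthonormal ℝ ((↑) : ({e} : Set E) → E) := by
    refine ⟨fun i => ?_, fun i j hij => (hij (Subsingleton.elim i j)).elim⟩
    rw [Set.mem_singleton_iff.1 i.2, hne]
  obtain ⟨v, q, hv, hq⟩ := hon.exists_orthonormalBasis_extension
  have hev : e ∈ v := by simpa using hv
  set k₀ : v := ⟨e, hev⟩
  have hk₀ : q k₀ = e := by rw [hq]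
  have hcard : (Finset.univ : Finset v).card = Module.finrank ℝ E := by
    rw [Module.finrank_eq_card_basis q.toBasis, Finset.card_univ]
  have hterm : ∀ k : v, iteratedFDeriv ℝ 2 u x ![q k, q k] - iteratedFDeriv ℝ 2 w y ![q k, q k] ≤
      (if k = k₀ then -(4 * A * κ ^ 2 * Real.exp (-κ * ‖x - y‖)) else 0) + 4 * B := fun k => by
    have hqk : ‖q k‖ = 1 := q.orthonormal.1 k
    split_ifs with hk
    · have hc : ∀ᶠ h : ℝ in 𝓝 0, ‖x + h • q k - (y + h • (-q k))‖ = ‖x - y‖ + 2 * h := by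
        have : ∀ᶠ h : ℝ in 𝓝 0, 0 < ‖x - y‖ + 2 * h :=
          (show ContinuousAt (fun h : ℝ => ‖x - y‖ + 2 * h) 0 by fun_prop)
            (isOpen_Ioi.mem_nhds (by simpa using hr))
        filter_upwards [this] with h hh
        have : x + h • q k - (y + h • (-q k)) = (‖x - y‖ + 2 * h) • e := by
          rw [add_smul, ← hre, hk, hk₀, mul_smul, two_smul, smul_neg]; abel
        rw [this, norm_smul, hne, mul_one, Real.norm_of_nonneg hh.le]
      have := iteratedFDeriv_two_sub_le_of_isLocalMax_doubling hu hw hmax hc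
      rw [norm_neg, hqk] at this
      have hneg : iteratedFDeriv ℝ 2 w y ![-q k, -q k] = iteratedFDeriv ℝ 2 w y ![q k, q k] := by
        simp [iteratedFDeriv_two_apply]
      rw [hneg] at this
      linarith
    · have hc : ∀ᶠ h : ℝ in 𝓝 0, ‖x + h • q k - (y + h • q k)‖ = ‖x - y‖ + 0 * h :=
        .of_forall fun h => by simp
      have := iteratedFDeriv_two_sub_le_of_isLocalMax_doubling hu hw hmax hc
      rw [hqk] at this
      linarith
  rw [laplacian_eq_iteratedFDeriv_orthonormalBasis u q,
    laplacian_eq_iteratedFDeriv_orthonormalBasis w q, ← Finset.sum_sub_distrib]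
  refine (Finset.sum_le_sum fun k _ => hterm k).trans (le_of_eq ?_)
  rw [Finset.sum_add_distrib, Finset.sum_ite_eq' Finset.univ k₀, if_pos (Finset.mem_univ _),
    Finset.sum_const, hcard, nsmul_eq_mul]
  ring

theorem fderiv_eq_and_laplacian_le_of_isLocalMax [FiniteDimensional ℝ E]
    (hu : ContDiff ℝ 2 u)
    (hmax : IsLocalMax (fun z => u z - A * ‖z - z₀‖ ^ 2) x) :
    (∀ α, fderiv ℝ u x α = 2 * A * inner ℝ (x - z₀) α) ∧
      Laplacian.laplacian u x ≤ 2 * A * Module.finrank ℝ E := by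
  have hline : ∀ α : E,
      IsLocalMax (fun h : ℝ => u (x + h • α) - A * ‖x + h • α - z₀‖ ^ 2) 0 := fun α => by
    have hc : ContinuousAt (fun h : ℝ => x + h • α) 0 := by fun_prop
    have h0 : (fun h : ℝ => x + h • α) 0 = x := by simp
    exact IsLocalMax.comp_continuous (b := (0 : ℝ)) (h0.symm ▸ hmax) hc
  have hderiv : ∀ (α : E) (h : ℝ),
      HasDerivAt (fun h : ℝ => u (x + h • α) - A * ‖x + h • α - z₀‖ ^ 2)
        (fderiv ℝ u (x + h • α) α - A * (2 * inner ℝ (x - z₀) α + ‖α‖ ^ 2 * (2 * h))) h :=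
    fun α h => (hasDerivAt_comp_line (hu.differentiable (by norm_num)) x α h).sub
      ((hasDerivAt_norm_add_smul_sub_sq x α z₀ h).const_mul A)
  refine ⟨fun α => ?_, ?_⟩
  · have := (hline α).hasDerivAt_eq_zero (hderiv α 0)
    simp only [zero_smul, add_zero, mul_zero] at this
    linarith
  · have hq : ∀ a b : ℝ, HasDerivAt (fun h : ℝ => a + b * (2 * h)) (b * 2) 0 := fun a b => by
      simpa using (((hasDerivAt_id (0 : ℝ)).const_mul 2).const_mul b).const_add a
    rw [laplacian_eq_iteratedFDeriv_stdOrthonormalBasis]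
    have hterm : ∀ k, iteratedFDeriv ℝ 2 u x
        ![stdOrthonormalBasis ℝ E k, stdOrthonormalBasis ℝ E k] ≤ 2 * A := fun k => by
      have := (hline (stdOrthonormalBasis ℝ E k)).second_deriv_nonpos (.of_forall (hderiv _))
        ((hasDerivAt_fderiv_comp_line hu x _).sub ((hq _ _).const_mul A))
      rw [(stdOrthonormalBasis ℝ E).orthonormal.1 k] at this
      linarith
    refine (Finset.sum_le_sum fun k _ => hterm k).trans (le_of_eq ?_)
    rw [Finset.sum_const, Finset.card_univ, Fintype.card_fin, nsmul_eq_mul]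
    ring

end Calculus

section Parabolic

open Filter Topology InnerProductSpace

variable {E : Type*} [NormedAddCommGroup E] [InnerProductSpace ℝ E] [FiniteDimensional ℝ E]

/-- `v` is a classical solution of `∂ₛv + ½Δv + b·Dv + f = 0` on `[t,T) × E`, and `v`, `b`, `f` are
bounded by `M`, `G`, `L` on the unit ball around `z₀`. -/
structure IsParabolicSolution (t T G L M : ℝ) (z₀ : E) (v : ℝ → E → ℝ) (b : ℝ → E → E)
    (f : ℝ → E → ℝ) : Prop where
  continuousOn : ContinuousOn (fun p : ℝ × E => v p.1 p.2) (Set.Icc t T ×ˢ Set.univ)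
  differentiableAt : ∀ z, ∀ s ∈ Set.Ico t T, DifferentiableAt ℝ (fun s' => v s' z) s
  contDiff : ∀ s ∈ Set.Ico t T, ContDiff ℝ 2 (v s)
  eqn : ∀ s ∈ Set.Ico t T, ∀ z, deriv (fun s' => v s' z) s
    + 1 / 2 * Laplacian.laplacian (v s) z + fderiv ℝ (v s) z (b s z) + f s z = 0
  norm_drift_le : ∀ s ∈ Set.Icc t T, ∀ z ∈ Metric.closedBall z₀ 1, ‖b s z‖ ≤ G
  abs_source_le : ∀ s ∈ Set.Icc t T, ∀ z ∈ Metric.closedBall z₀ 1, |f s z| ≤ L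
  abs_value_le : ∀ s ∈ Set.Icc t T, ∀ z ∈ Metric.closedBall z₀ 1, |v s z| ≤ M

namespace IsParabolicSolution

variable {t T G L M : ℝ} {z₀ : E} {v : ℝ → E → ℝ} {b : ℝ → E → E} {f : ℝ → E → ℝ}

theorem neg (h : IsParabolicSolution t T G L M z₀ v b f) :
    IsParabolicSolution t T G L M z₀ (fun s z => -v s z) b (fun s z => -f s z) where
  continuousOn := h.continuousOn.neg
  differentiableAt z s hs := (h.differentiableAt z s hs).neg
  contDiff s hs := (h.contDiff s hs).neg
  eqn s hs z := by
    have hl : Laplacian.laplacian (fun z => -v s z) z = -Laplacian.laplacian (v s) z :=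
      congrFun (laplacian_neg (f := v s)) z
    rw [deriv.fun_neg, fderiv_fun_neg, hl, _root_.neg_apply]
    linarith [h.eqn s hs z]
  norm_drift_le := h.norm_drift_le
  abs_source_le s hs z hz := by simpa using h.abs_source_le s hs z hz
  abs_value_le s hs z hz := by simpa using h.abs_value_le s hs z hz

theorem mono (h : IsParabolicSolution t T G L M z₀ v b f) {t' T' : ℝ} (ht : t ≤ t')
    (hT : T' ≤ T) : IsParabolicSolution t' T' G L M z₀ v b f :=
  have hI : Set.Icc t' T' ⊆ Set.Icc t T := Set.Icc_subset_Icc ht hT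
  have hI' : Set.Ico t' T' ⊆ Set.Ico t T := Set.Ico_subset_Ico ht hT
  { continuousOn := h.continuousOn.mono (Set.prod_mono_left hI)
    differentiableAt := fun z s hs => h.differentiableAt z s (hI' hs)
    contDiff := fun s hs => h.contDiff s (hI' hs)
    eqn := fun s hs => h.eqn s (hI' hs)
    norm_drift_le := fun s hs => h.norm_drift_le s (hI hs)
    abs_source_le := fun s hs => h.abs_source_le s (hI hs)
    abs_value_le := fun s hs => h.abs_value_le s (hI hs) }

theorem sub_le_mul_norm (h : IsParabolicSolution t T G L M z₀ v b f) (hG : 0 ≤ G) (hL : 0 ≤ L)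
    (hM : 0 ≤ M) {N : ℝ} (hN : 0 ≤ N)
    (hterm : ∀ z ∈ Metric.closedBall z₀ 1, ∀ w ∈ Metric.closedBall z₀ 1,
      v T z - v T w ≤ N * ‖z - w‖) {κ A B : ℝ} (hκ : κ = G + 1) (hB : B = 2 * M)
    (hA : A = Real.exp (2 * κ) * (Module.finrank ℝ E * B + 2 * G * B + L + N + 1))
    {s : ℝ} (hs : s ∈ Set.Icc t T) {z : E} (hz : z ∈ Metric.closedBall z₀ 1) :
    v s z₀ - v s z ≤ (A * κ + B) * ‖z - z₀‖ := by
  have hκ1 : 1 ≤ κ := by linarith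
  have hB0 : 0 ≤ B := by rw [hB]; positivity
  have hd : (0 : ℝ) ≤ Module.finrank ℝ E := Nat.cast_nonneg _
  have hA0 : 0 ≤ A := by rw [hA]; positivity
  have hAexp : A * Real.exp (-(2 * κ)) = Module.finrank ℝ E * B + 2 * G * B + L + N + 1 := by
    rw [hA, mul_right_comm, ← Real.exp_add, add_neg_cancel, Real.exp_zero, one_mul]
  have hr2 : ∀ {p q : E}, p ∈ Metric.closedBall z₀ 1 → q ∈ Metric.closedBall z₀ 1 →
      ‖p - q‖ ≤ 2 := fun {p q} hp hq => by
    rw [← dist_eq_norm]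
    linarith [dist_triangle_right p q z₀, Metric.mem_closedBall.1 hp, Metric.mem_closedBall.1 hq]
  have hexp : ∀ {p q : E}, p ∈ Metric.closedBall z₀ 1 → q ∈ Metric.closedBall z₀ 1 →
      Real.exp (-(2 * κ)) ≤ Real.exp (-κ * ‖p - q‖) := fun {p q} hp hq =>
    Real.exp_le_exp.2 (by nlinarith [hr2 hp hq])
  set S : Set (ℝ × E × E) :=
    Set.Icc t T ×ˢ (Metric.closedBall z₀ 1 ×ˢ Metric.closedBall z₀ 1)
  set Φ : ℝ × E × E → ℝ := fun p => doubling A B κ z₀ (v p.1) (v p.1) p.2 with hΦ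
  have hcompact : IsCompact S :=
    isCompact_Icc.prod ((isCompact_closedBall z₀ 1).prod (isCompact_closedBall z₀ 1))
  have hcont : ContinuousOn Φ S := by
    have h1 : ContinuousOn (fun p : ℝ × E × E => v p.1 p.2.1) S :=
      h.continuousOn.comp (f := fun p : ℝ × E × E => (p.1, p.2.1)) (by fun_prop)
        fun p hp => ⟨hp.1, trivial⟩
    have h2 : ContinuousOn (fun p : ℝ × E × E => v p.1 p.2.2) S :=
      h.continuousOn.comp (f := fun p : ℝ × E × E => (p.1, p.2.2)) (by fun_prop)
        fun p hp => ⟨hp.1, trivial⟩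
    exact ((h1.sub h2).sub (Continuous.continuousOn (by fun_prop))).sub
      (Continuous.continuousOn (by fun_prop))
  have hz₀ : z₀ ∈ Metric.closedBall z₀ 1 := Metric.mem_closedBall_self zero_le_one
  have key : ∀ p ∈ S, Φ p ≤ 0 := by
    obtain ⟨⟨s₀, x, y⟩, ⟨hs₀, hx, hy⟩, hmax⟩ :=
      hcompact.exists_isMaxOn ⟨(s, z₀, z₀), hs, hz₀, hz₀⟩ hcont
    simp only at hs₀ hx hy
    suffices h0 : Φ (s₀, x, y) ≤ 0 from fun p hp => (hmax hp).trans h0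
    by_contra! hpos
    have hψ : 0 ≤ A * (1 - Real.exp (-κ * ‖x - y‖)) :=
      mul_nonneg hA0 (sub_nonneg.2 (Real.exp_le_one_iff.2 (by nlinarith [norm_nonneg (x - y)])))
    have hvx := abs_le.1 (h.abs_value_le s₀ hs₀ x hx)
    have hvy := abs_le.1 (h.abs_value_le s₀ hs₀ y hy)
    have hpos' := hpos
    simp only [hΦ, doubling] at hpos'
    rw [mem_closedBall_iff_norm] at hx hy
    have hx1 : ‖x - z₀‖ < 1 := by
      refine lt_of_le_of_ne hx fun heq => ?_
      rw [heq] at hpos'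
      nlinarith [mul_nonneg hB0 (sq_nonneg ‖y - z₀‖)]
    have hy1 : ‖y - z₀‖ < 1 := by
      refine lt_of_le_of_ne hy fun heq => ?_
      rw [heq] at hpos'
      nlinarith [mul_nonneg hB0 (sq_nonneg ‖x - z₀‖)]
    have hxy : x ≠ y := by
      rintro rfl
      simp only [sub_self, norm_zero, mul_zero, Real.exp_zero] at hpos'
      nlinarith [mul_nonneg hB0 (sq_nonneg ‖x - z₀‖)]
    rw [← mem_closedBall_iff_norm] at hx hy
    have hsT : s₀ < T := by
      refine lt_of_le_of_ne hs₀.2 fun heq => ?_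
      subst heq
      have h1 := hterm x hx y hy
      have hr := norm_nonneg (x - y)
      have h2 : ‖x - y‖ * Real.exp (-κ * ‖x - y‖) ≤ 1 - Real.exp (-κ * ‖x - y‖) := by
        have h3 := Real.add_one_le_exp (κ * ‖x - y‖)
        have h4 : Real.exp (κ * ‖x - y‖) * Real.exp (-κ * ‖x - y‖) = 1 := by
          rw [← Real.exp_add]; simp
        nlinarith [mul_le_mul_of_nonneg_right h3 (Real.exp_pos (-κ * ‖x - y‖)).le,
          mul_nonneg (mul_nonneg (sub_nonneg.2 hκ1) hr) (Real.exp_pos (-κ * ‖x - y‖)).le]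
      have h5 : N * ‖x - y‖ ≤ A * (1 - Real.exp (-κ * ‖x - y‖)) := by
        calc N * ‖x - y‖ ≤ (A * Real.exp (-(2 * κ))) * ‖x - y‖ := by
              refine mul_le_mul_of_nonneg_right ?_ hr
              rw [hAexp]
              linarith [mul_nonneg hd hB0, mul_nonneg (mul_nonneg zero_le_two hG) hB0]
          _ = A * (‖x - y‖ * Real.exp (-(2 * κ))) := by ring
          _ ≤ A * (‖x - y‖ * Real.exp (-κ * ‖x - y‖)) :=
              mul_le_mul_of_nonneg_left (mul_le_mul_of_nonneg_left (hexp hx hy) hr) hA0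
          _ ≤ _ := by gcongr
      nlinarith [mul_nonneg hB0 (sq_nonneg ‖x - z₀‖), mul_nonneg hB0 (sq_nonneg ‖y - z₀‖)]
    have hs₀' : s₀ ∈ Set.Ico t T := ⟨hs₀.1, hsT⟩
    have htime : deriv (fun s' => v s' x) s₀ - deriv (fun s' => v s' y) s₀ ≤ 0 := by
      refine ((h.differentiableAt x s₀ hs₀').hasDerivAt.sub
        (h.differentiableAt y s₀ hs₀').hasDerivAt).nonpos_of_eventually_le ?_
      filter_upwards [Ioc_mem_nhdsGT hsT] with s' hs'
      have := hmax (show (s', x, y) ∈ S from ⟨⟨hs₀.1.trans hs'.1.le, hs'.2⟩, hx, hy⟩)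
      simp only [hΦ, doubling, Set.mem_ofPred_eq] at this
      simp only [Pi.sub_apply]
      linarith
    have hloc : IsLocalMax (doubling A B κ z₀ (v s₀) (v s₀)) (x, y) := by
      have hnhds : Metric.closedBall z₀ 1 ×ˢ Metric.closedBall z₀ 1 ∈ 𝓝 (x, y) :=
        prod_mem_nhds (Metric.closedBall_mem_nhds_of_mem (mem_ball_iff_norm.2 hx1))
          (Metric.closedBall_mem_nhds_of_mem (mem_ball_iff_norm.2 hy1))
      filter_upwards [hnhds] with p hp
      exact hmax (show (s₀, p) ∈ S from ⟨hs₀, hp⟩)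
    have hC := h.contDiff s₀ hs₀'
    have hsecond := laplacian_sub_le_of_isLocalMax_doubling hC hC hxy hloc
    have hfirst := fderiv_sub_fderiv_le_of_isLocalMax_doubling hA0 (by linarith)
      (hC.differentiable (by norm_num)) (hC.differentiable (by norm_num)) hloc (b s₀ x) (b s₀ y)
    have hbx := h.norm_drift_le s₀ hs₀ x hx
    have hby := h.norm_drift_le s₀ hs₀ y hy
    have hix : inner ℝ (x - z₀) (b s₀ x) ≤ G := by
      calc inner ℝ (x - z₀) (b s₀ x) ≤ ‖x - z₀‖ * ‖b s₀ x‖ := real_inner_le_norm _ _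
        _ ≤ 1 * G := by gcongr
        _ = G := one_mul G
    have hiy : inner ℝ (y - z₀) (b s₀ y) ≤ G := by
      calc inner ℝ (y - z₀) (b s₀ y) ≤ ‖y - z₀‖ * ‖b s₀ y‖ := real_inner_le_norm _ _
        _ ≤ 1 * G := by gcongr
        _ = G := one_mul G
    have hbb : ‖b s₀ x - b s₀ y‖ ≤ 2 * G := (norm_sub_le _ _).trans (by linarith)
    set Q := A * κ * Real.exp (-κ * ‖x - y‖) with hQ
    have hQ0 : 0 ≤ Q := by positivity
    have h1 : Q * ‖b s₀ x - b s₀ y‖ ≤ Q * (2 * G) := by gcongr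
    have h2 : 2 * B * (inner ℝ (x - z₀) (b s₀ x) + inner ℝ (y - z₀) (b s₀ y)) ≤
        2 * B * (2 * G) := by gcongr; linarith
    have hQκ : 4 * A * κ ^ 2 * Real.exp (-κ * ‖x - y‖) = 4 * Q * (G + 1) := by
      rw [hQ, ← hκ]; ring
    have hQlow : A * Real.exp (-(2 * κ)) ≤ Q := by
      rw [hQ, mul_assoc]
      refine mul_le_mul_of_nonneg_left ?_ hA0
      nlinarith [hexp hx hy, Real.exp_pos (-κ * ‖x - y‖)]
    have hex := h.eqn s₀ hs₀' x
    have hey := h.eqn s₀ hs₀' y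
    have hlx := abs_le.1 (h.abs_source_le s₀ hs₀ x hx)
    have hly := abs_le.1 (h.abs_source_le s₀ hs₀ y hy)
    rw [hQκ] at hsecond
    rw [hAexp] at hQlow
    linarith
  have hfin := key (s, z₀, z) ⟨hs, hz₀, hz⟩
  simp only [hΦ, doubling, sub_self, norm_zero] at hfin
  rw [norm_sub_rev z₀ z] at hfin
  rw [mem_closedBall_iff_norm] at hz
  have h1 : A * (1 - Real.exp (-κ * ‖z - z₀‖)) ≤ A * (κ * ‖z - z₀‖) := by
    gcongr
    linarith [Real.add_one_le_exp (-κ * ‖z - z₀‖)]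
  have h2 : B * ‖z - z₀‖ ^ 2 ≤ B * ‖z - z₀‖ := by
    gcongr
    nlinarith [norm_nonneg (z - z₀)]
  linarith

theorem sub_terminal_le (h : IsParabolicSolution t T G L M z₀ v b f) (htT : t ≤ T)
    (hM : 0 ≤ M) {C ρ A Λ : ℝ} (hC : 0 ≤ C) (hρ : 0 < ρ)
    (hlip : ∀ z ∈ Metric.closedBall z₀ 1, |v T z - v T z₀| ≤ C * ‖z - z₀‖)
    (hA : A = 2 * M + C / ρ) (hΛ : Λ = A * (Module.finrank ℝ E + 2 * G) + L + 1) :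
    v t z₀ - v T z₀ ≤ C * ρ + Λ * (T - t) := by
  have hA0 : 0 ≤ A := by rw [hA]; positivity
  have hCρ : 0 ≤ C * ρ := by positivity
  set S : Set (ℝ × E) := Set.Icc t T ×ˢ Metric.closedBall z₀ 1
  set Φ : ℝ × E → ℝ := fun p => v p.1 p.2 - v T z₀ - C * ρ - A * ‖p.2 - z₀‖ ^ 2
    - Λ * (T - p.1) with hΦ
  have hz₀ : z₀ ∈ Metric.closedBall z₀ 1 := Metric.mem_closedBall_self zero_le_one
  have ht : t ∈ Set.Icc t T := ⟨le_rfl, htT⟩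
  have hT : T ∈ Set.Icc t T := ⟨htT, le_rfl⟩
  have hcont : ContinuousOn Φ S := by
    have h1 : ContinuousOn (fun p : ℝ × E => v p.1 p.2) S :=
      h.continuousOn.mono fun p hp => ⟨hp.1, trivial⟩
    simp only [hΦ]
    fun_prop
  have hG : 0 ≤ G := (norm_nonneg _).trans (h.norm_drift_le t ht z₀ hz₀)
  have hL : 0 ≤ L := (abs_nonneg _).trans (h.abs_source_le t ht z₀ hz₀)
  have hΛ0 : 0 ≤ Λ := by rw [hΛ]; positivity
  obtain ⟨⟨s₀, x⟩, ⟨hs₀, hx⟩, hmax⟩ :=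
    (isCompact_Icc.prod (isCompact_closedBall z₀ 1)).exists_isMaxOn ⟨(t, z₀), ht, hz₀⟩ hcont
  simp only at hs₀ hx
  have h0 : Φ (s₀, x) ≤ 0 := by
    by_contra! hpos
    have hpos' := hpos
    simp only [hΦ] at hpos'
    have hΛs : 0 ≤ Λ * (T - s₀) := mul_nonneg hΛ0 (sub_nonneg.2 hs₀.2)
    have hx1 : ‖x - z₀‖ < 1 := by
      refine lt_of_le_of_ne (mem_closedBall_iff_norm.1 hx) fun heq => ?_
      rw [heq, hA] at hpos'
      have : 0 ≤ C / ρ := by positivity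
      linarith [abs_le.1 (h.abs_value_le s₀ hs₀ x hx), abs_le.1 (h.abs_value_le T hT z₀ hz₀)]
    have hsT : s₀ < T := by
      refine lt_of_le_of_ne hs₀.2 fun heq => ?_
      subst heq
      have h1 := (le_abs_self _).trans (hlip x hx)
      have h2 : C * ‖x - z₀‖ ≤ C * ρ + C / ρ * ‖x - z₀‖ ^ 2 := by
        have : C * ρ + C / ρ * ‖x - z₀‖ ^ 2 - C * ‖x - z₀‖ =
            C / ρ * ((ρ - ‖x - z₀‖ / 2) ^ 2 + 3 / 4 * ‖x - z₀‖ ^ 2) := by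
          field_simp
          ring
        have : 0 ≤ C / ρ * ((ρ - ‖x - z₀‖ / 2) ^ 2 + 3 / 4 * ‖x - z₀‖ ^ 2) := by positivity
        linarith
      have h3 : C / ρ * ‖x - z₀‖ ^ 2 ≤ A * ‖x - z₀‖ ^ 2 := by
        gcongr
        linarith
      linarith
    have hs₀' : s₀ ∈ Set.Ico t T := ⟨hs₀.1, hsT⟩
    have htime : deriv (fun s' => v s' x) s₀ + Λ ≤ 0 := by
      have hd : HasDerivAt (fun s' => v s' x + Λ * s') (deriv (fun s' => v s' x) s₀ + Λ) s₀ := by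
        simpa using (h.differentiableAt x s₀ hs₀').hasDerivAt.fun_add
          ((hasDerivAt_id' s₀).const_mul Λ)
      refine hd.nonpos_of_eventually_le ?_
      filter_upwards [Ioc_mem_nhdsGT hsT] with s' hs'
      have := hmax (show (s', x) ∈ S from ⟨⟨hs₀.1.trans hs'.1.le, hs'.2⟩, hx⟩)
      simp only [hΦ, Set.mem_ofPred_eq] at this
      linarith
    have hloc : IsLocalMax (fun z => v s₀ z - A * ‖z - z₀‖ ^ 2) x := by
      filter_upwards [Metric.closedBall_mem_nhds_of_mem (mem_ball_iff_norm.2 hx1)] with p hp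
      have := hmax (show (s₀, p) ∈ S from ⟨hs₀, hp⟩)
      simp only [hΦ, Set.mem_ofPred_eq] at this
      linarith
    obtain ⟨hfirst, hsecond⟩ := fderiv_eq_and_laplacian_le_of_isLocalMax (h.contDiff s₀ hs₀') hloc
    have hix : inner ℝ (x - z₀) (b s₀ x) ≤ G := by
      calc inner ℝ (x - z₀) (b s₀ x) ≤ ‖x - z₀‖ * ‖b s₀ x‖ := real_inner_le_norm _ _
        _ ≤ 1 * G := by
          gcongr
          exact h.norm_drift_le s₀ hs₀ x hx
        _ = G := one_mul G
    have h1 : 2 * A * inner ℝ (x - z₀) (b s₀ x) ≤ 2 * A * G := by gcongr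
    have hex := h.eqn s₀ hs₀' x
    rw [hfirst] at hex
    have hlx := abs_le.1 (h.abs_source_le s₀ hs₀ x hx)
    nlinarith
  have := (hmax (show (t, z₀) ∈ S from ⟨ht, hz₀⟩)).trans h0
  simp only [hΦ, sub_self, norm_zero] at this
  linarith

theorem abs_sub_le_of_time (h : IsParabolicSolution t T G L M z₀ v b f) (hM : 0 ≤ M)
    {C D : ℝ} (hC : 0 ≤ C) (hD : D = Module.finrank ℝ E + 2 * G)
    (hlip : ∀ s ∈ Set.Icc t T, ∀ z ∈ Metric.closedBall z₀ 1, |v s z - v s z₀| ≤ C * ‖z - z₀‖)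
    {s₁ s₂ : ℝ} (hs₁ : s₁ ∈ Set.Icc t T) (hs₂ : s₂ ∈ Set.Icc t T) :
    |v s₁ z₀ - v s₂ z₀| ≤ C * (1 + D) * √|s₁ - s₂| + (2 * M * D + L + 1) * |s₁ - s₂| := by
  wlog h12 : s₁ ≤ s₂ generalizing s₁ s₂
  · rw [abs_sub_comm, abs_sub_comm s₁]
    exact this hs₂ hs₁ (le_of_not_ge h12)
  rcases h12.eq_or_lt with rfl | hlt
  · simp
  have hpos : 0 < s₂ - s₁ := sub_pos.2 hlt
  have hsqrt : 0 < √(s₂ - s₁) := Real.sqrt_pos.2 hpos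
  rw [abs_sub_comm s₁ s₂, abs_of_pos hpos]
  have hr := h.mono hs₁.1 hs₂.2
  have heq : C * √(s₂ - s₁) + ((2 * M + C / √(s₂ - s₁)) * (Module.finrank ℝ E + 2 * G) + L + 1)
      * (s₂ - s₁) = C * (1 + D) * √(s₂ - s₁) + (2 * M * D + L + 1) * (s₂ - s₁) := by
    have : C / √(s₂ - s₁) * (s₂ - s₁) = C * √(s₂ - s₁) := by
      rw [div_mul_eq_mul_div, div_eq_iff hsqrt.ne', mul_assoc, Real.mul_self_sqrt hpos.le]
    rw [← hD]
    linear_combination D * this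
  rw [← heq, abs_le', neg_sub]
  refine ⟨hr.sub_terminal_le h12 hM hC hsqrt (hlip s₂ hs₂) rfl rfl, ?_⟩
  have := hr.neg.sub_terminal_le h12 hM hC hsqrt (fun z hz => ?_) rfl rfl
  · linarith
  · rw [neg_sub_neg, abs_sub_comm]
    exact hlip s₂ hs₂ z hz

end IsParabolicSolution

/-- Interior Lipschitz bound in space and `1/2`-Hölder bound in time, with a constant depending only
on the bounds of the data. -/
theorem exists_parabolic_modulus (E : Type*) [NormedAddCommGroup E] [InnerProductSpace ℝ E]
    [FiniteDimensional ℝ E] {G L M N : ℝ} (hG : 0 ≤ G) (hL : 0 ≤ L) (hM : 0 ≤ M) (hN : 0 ≤ N) :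
    ∃ C : ℝ, 0 ≤ C ∧ ∀ (t T : ℝ) (z₀ : E) (v : ℝ → E → ℝ) (b : ℝ → E → E) (f : ℝ → E → ℝ),
      IsParabolicSolution t T G L M z₀ v b f →
      (∀ z ∈ Metric.closedBall z₀ 1, ∀ w ∈ Metric.closedBall z₀ 1,
        |v T z - v T w| ≤ N * ‖z - w‖) →
      (∀ s ∈ Set.Icc t T, ∀ z ∈ Metric.closedBall z₀ 1, |v s z - v s z₀| ≤ C * ‖z - z₀‖) ∧
      ∀ s₁ ∈ Set.Icc t T, ∀ s₂ ∈ Set.Icc t T,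
        |v s₁ z₀ - v s₂ z₀| ≤ C * (√|s₁ - s₂| + |s₁ - s₂|) := by
  obtain ⟨κ, hκ⟩ : ∃ κ, κ = G + 1 := ⟨_, rfl⟩
  obtain ⟨B, hB⟩ : ∃ B, B = 2 * M := ⟨_, rfl⟩
  obtain ⟨A, hA⟩ : ∃ A, A = Real.exp (2 * κ) *
    (Module.finrank ℝ E * B + 2 * G * B + L + N + 1) := ⟨_, rfl⟩
  obtain ⟨D, hD⟩ : ∃ D, D = Module.finrank ℝ E + 2 * G := ⟨_, rfl⟩
  have hκ0 : 0 ≤ κ := by rw [hκ]; positivity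
  have hB0 : 0 ≤ B := by rw [hB]; positivity
  have hA0 : 0 ≤ A := by rw [hA]; positivity
  have hD0 : 0 ≤ D := by rw [hD]; positivity
  set C₁ := A * κ + B with hC₁
  have hC₁0 : 0 ≤ C₁ := by positivity
  have hle : C₁ ≤ C₁ * (1 + D) + (2 * M * D + L + 1) := by
    have : 0 ≤ C₁ * D + (2 * M * D + L + 1) := by positivity
    linarith
  refine ⟨C₁ * (1 + D) + (2 * M * D + L + 1), hC₁0.trans hle, fun t T z₀ v b f h hterm => ?_⟩
  have hlip : ∀ s ∈ Set.Icc t T, ∀ z ∈ Metric.closedBall z₀ 1,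
      |v s z - v s z₀| ≤ C₁ * ‖z - z₀‖ := fun s hs z hz => by
    have h1 := h.sub_le_mul_norm hG hL hM hN
      (fun z hz w hw => (le_abs_self _).trans (hterm z hz w hw)) hκ hB hA hs hz
    have h2 := h.neg.sub_le_mul_norm hG hL hM hN
      (fun z hz w hw => by
        rw [neg_sub_neg]
        exact (le_abs_self _).trans (abs_sub_comm (v T w) _ ▸ hterm z hz w hw)) hκ hB hA hs hz
    rw [abs_le']
    constructor <;> linarith
  refine ⟨fun s hs z hz => (hlip s hs z hz).trans (by gcongr), fun s₁ hs₁ s₂ hs₂ =>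
    (h.abs_sub_le_of_time hM hC₁0 hD hlip hs₁ hs₂).trans ?_⟩
  have hC₁D : 0 ≤ C₁ * (1 + D) := by positivity
  have hMD : 0 ≤ 2 * M * D + L + 1 := by positivity
  linarith [mul_nonneg hMD (Real.sqrt_nonneg |s₁ - s₂|), mul_nonneg hC₁D (abs_nonneg (s₁ - s₂))]

end Parabolic

section LinearChange

open InnerProductSpace

theorem secondPartial_eq {n : ℕ} {φ : Euc n → ℝ} (hφ : ContDiff ℝ 2 φ) (x : Euc n)
    (i j : Fin n) :
    secondPartial n φ x i j =
      fderiv ℝ (fderiv ℝ φ) x (EuclideanSpace.single i 1) (EuclideanSpace.single j 1) := by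
  have hd : DifferentiableAt ℝ (fderiv ℝ φ) x :=
    ((hφ.fderiv_right (m := 1) (by norm_num)).differentiable (by norm_num)) x
  rw [secondPartial, fderiv_clm_apply hd (differentiableAt_const _)]
  simp

theorem laplacian_comp_toEuclideanCLM {n : ℕ} (S : Matrix (Fin n) (Fin n) ℝ) {φ : Euc n → ℝ}
    (hφ : ContDiff ℝ 2 φ) (z : Euc n) :
    1 / 2 * Laplacian.laplacian (fun z => φ (Matrix.toEuclideanCLM (𝕜 := ℝ) S z)) z =
      -opA n (S * Sᵀ) φ (Matrix.toEuclideanCLM (𝕜 := ℝ) S z) := by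
  set F := Matrix.toEuclideanCLM (𝕜 := ℝ) S with hF
  have hcol : ∀ k, F (EuclideanSpace.single k 1) = ∑ i, S i k • EuclideanSpace.single i (1 : ℝ) := by
    intro k
    ext i
    simp [hF, EuclideanSpace.single, Pi.single_apply]
  have hlap : Laplacian.laplacian (φ ∘ F) z =
      ∑ k, ∑ i, ∑ j, S i k * S j k * secondPartial n φ (F z) i j := by
    rw [laplacian_eq_iteratedFDeriv_orthonormalBasis _ (EuclideanSpace.basisFun (Fin n) ℝ)]
    refine Finset.sum_congr rfl fun k _ => ?_
    rw [F.iteratedFDeriv_comp_right hφ z (by norm_num),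
      ContinuousMultilinearMap.compContinuousLinearMap_apply, iteratedFDeriv_two_apply]
    simp only [EuclideanSpace.basisFun_apply, Matrix.cons_val_zero, Matrix.cons_val_one, hcol,
      map_sum, map_smul, _root_.sum_apply, _root_.smul_apply,
      smul_eq_mul, Finset.mul_sum, secondPartial_eq hφ]
    rw [Finset.sum_comm]
    refine Finset.sum_congr rfl fun i _ => Finset.sum_congr rfl fun j _ => ?_
    ring
  change 1 / 2 * Laplacian.laplacian (φ ∘ F) z = _
  rw [hlap, opA, neg_mul, neg_neg]
  congr 1
  simp only [Matrix.mul_apply, Matrix.transpose_apply, Finset.sum_mul]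
  rw [Finset.sum_comm]
  exact Finset.sum_congr rfl fun i _ => Finset.sum_comm

end LinearChange

theorem le_one_add_mul_rpow {r ρ δ : ℝ} (hr : 0 ≤ r) (hrρ : r ≤ ρ) (hδ : 0 < δ) (hδ1 : δ ≤ 1) :
    r ≤ (1 + ρ) * r ^ δ := by
  have hp : 0 ≤ r ^ δ := Real.rpow_nonneg hr δ
  rcases le_total r 1 with h | h
  · have : r ≤ r ^ δ := by
      simpa using Real.rpow_le_rpow_of_exponent_ge' hr h hδ.le hδ1
    nlinarith [mul_nonneg (hr.trans hrρ) hp]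
  · nlinarith [Real.one_le_rpow h hδ.le]

/-- **Theorem 5.1.** Interior Hölder estimate for the linear parabolic
equation `−∂_s J + 𝒜J − g·DJ = l`, `J(T,·) = l_T`: for every bounded open set `O ⊂ ℝⁿ`
there exist `δ₀ ∈ (0,1/2)` and `C > 0`, depending only on the closure of `O`, `T−t`, `n`,
`a` and `K`, such that
`|J(s₁,x₁) − J(s₂,x₂)| ≤ C(|x₁−x₂|^{2δ₀} + |s₁−s₂|^{δ₀})` on `cl(O) × [t,T]`. -/
theorem interior_holder_estimate
    (n : ℕ) (hn : 1 ≤ n) (σM : Matrix (Fin n) (Fin n) ℝ) (hσ : IsUnit σM.det)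
    (a : Matrix (Fin n) (Fin n) ℝ) (ha : a = σM * σMᵀ)
    (t T K : ℝ) (htT : t < T) (hK : 0 < K) :
    ∀ O : Set (Euc n), IsOpen O → Bornology.IsBounded O →
    ∃ δ₀ ∈ Set.Ioo (0 : ℝ) (1 / 2), ∃ C > (0 : ℝ),
      ∀ (g : ℝ → Euc n → Euc n) (l : ℝ → Euc n → ℝ) (lT : Euc n → ℝ) (J : ℝ → Euc n → ℝ),
      -- continuity and growth of the coefficients
      ContinuousOn (fun p : ℝ × Euc n => g p.1 p.2) (Set.Icc t T ×ˢ Set.univ) →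
      (∀ s ∈ Set.Icc t T, ∀ x : Euc n, ‖g s x‖ ≤ K * (1 + ‖x‖)) →
      ContinuousOn (fun p : ℝ × Euc n => l p.1 p.2) (Set.Icc t T ×ˢ Set.univ) →
      (∀ s ∈ Set.Icc t T, ∀ x : Euc n, |l s x| ≤ K * (1 + ‖x‖ ^ 2)) →
      ContDiff ℝ 1 lT →
      (∀ x : Euc n, |lT x| ≤ K * (1 + ‖x‖ ^ 2)) →
      (∀ x : Euc n, ‖gradient lT x‖ ≤ K * (1 + ‖x‖)) →
      -- regularity of J : continuous, C¹ in s and C² in x on [t,T)×ℝⁿ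
      ContinuousOn (fun p : ℝ × Euc n => J p.1 p.2) (Set.Icc t T ×ˢ Set.univ) →
      (∀ x : Euc n, ∀ s ∈ Set.Ico t T, DifferentiableAt ℝ (fun σ' => J σ' x) s) →
      (∀ s ∈ Set.Ico t T, ContDiff ℝ 2 (J s)) →
      -- the equation with terminal data l_T
      (∀ s ∈ Set.Ico t T, ∀ x : Euc n,
        -(deriv (fun σ' => J σ' x) s) + opA n a (J s) x - ⟪g s x, gradient (J s) x⟫ = l s x) →
      (∀ x : Euc n, J T x = lT x) →
      -- quadratic growth of J
      (∀ s ∈ Set.Icc t T, ∀ x : Euc n, |J s x| ≤ K * (1 + ‖x‖ ^ 2)) →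
      -- conclusion
      ∀ x₁ ∈ closure O, ∀ x₂ ∈ closure O, ∀ s₁ ∈ Set.Icc t T, ∀ s₂ ∈ Set.Icc t T,
        |J s₁ x₁ - J s₂ x₂| ≤ C * (‖x₁ - x₂‖ ^ (2 * δ₀) + |s₁ - s₂| ^ δ₀) := by
  intro O _ hOb
  obtain ⟨R₀, hR₀⟩ := hOb.closure.subset_closedBall (0 : Euc n)
  set R := max R₀ 0
  have hR0 : 0 ≤ R := le_max_right _ _
  have hR : ∀ x ∈ closure O, ‖x‖ ≤ R := fun x hx =>
    (mem_closedBall_zero_iff.1 (hR₀ hx)).trans (le_max_left _ _)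
  set F := Matrix.toEuclideanCLM (𝕜 := ℝ) σM with hF
  set F' := Matrix.toEuclideanCLM (𝕜 := ℝ) σM⁻¹ with hF'
  have hFF' : ∀ x, F (F' x) = x := fun x => by
    rw [← mul_apply_eq_comp, hF, hF', ← map_mul, Matrix.mul_nonsing_inv _ hσ, map_one]
    rfl
  set R' := ‖F‖ * (‖F'‖ * R + 1)
  have hR'0 : 0 ≤ R' := by positivity
  have hball : ∀ x ∈ closure O, ∀ z ∈ Metric.closedBall (F' x) 1, ‖F z‖ ≤ R' := fun x hx z hz => by
    refine (F.le_opNorm z).trans (mul_le_mul_of_nonneg_left ?_ (norm_nonneg _))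
    calc ‖z‖ ≤ ‖F' x‖ + ‖z - F' x‖ := norm_le_norm_add_norm_sub' _ _
      _ ≤ ‖F'‖ * R + 1 := add_le_add ((F'.le_opNorm x).trans (by gcongr; exact hR x hx))
          (mem_closedBall_iff_norm.1 hz)
  set G := ‖F'‖ * (K * (1 + R'))
  set M := K * (1 + R' ^ 2)
  set N := K * (1 + R') * ‖F‖
  have hM0 : 0 ≤ M := by positivity
  obtain ⟨C, hC0, hC⟩ := exists_parabolic_modulus (Euc n) (G := G) (L := M) (M := M) (N := N)
    (by positivity) hM0 hM0 (by positivity)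
  set C₁ := (C + 2 * M) * ‖F'‖ * (1 + 2 * R)
  set C₂ := C * ((1 + √(T - t)) + (1 + (T - t)))
  have hτ : 0 ≤ T - t := sub_nonneg.2 htT.le
  have hC₁ : 0 ≤ C₁ := by positivity
  have hC₂ : 0 ≤ C₂ := by positivity
  refine ⟨1 / 4, by norm_num, C₁ + C₂ + 1, by positivity, ?_⟩
  intro g l lT J _ hg _ hl hlT _ hDlT hJ hJs hJx heq hJT hJK x₁ hx₁ x₂ hx₂ s₁ hs₁ s₂ hs₂
  have hT : T ∈ Set.Icc t T := ⟨htT.le, le_rfl⟩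
  have hsol : ∀ x ∈ closure O, IsParabolicSolution t T G M M (F' x) (fun s z => J s (F z))
      (fun s z => F' (g s (F z))) (fun s z => l s (F z)) := fun x hx =>
    { continuousOn := hJ.comp (f := fun p : ℝ × Euc n => (p.1, F p.2)) (by fun_prop)
        fun p hp => ⟨hp.1, trivial⟩
      differentiableAt := fun z s hs => hJs (F z) s hs
      contDiff := fun s hs => (hJx s hs).comp F.contDiff
      eqn := fun s hs z => by
        have hd : fderiv ℝ (fun z => J s (F z)) z (F' (g s (F z))) =
            fderiv ℝ (J s) (F z) (g s (F z)) := by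
          have h1 : HasFDerivAt (fun z => J s (F z)) ((fderiv ℝ (J s) (F z)).comp
              (F : Euc n →L[ℝ] Euc n)) z :=
            (((hJx s hs).differentiable (by norm_num)) (F z)).hasFDerivAt.comp z F.hasFDerivAt
          rw [h1.fderiv, ContinuousLinearMap.comp_apply, hFF']
        have h2 := heq s hs (F z)
        rw [inner_gradient_right, conj_trivial, ha] at h2
        rw [laplacian_comp_toEuclideanCLM σM (hJx s hs) z, hd]
        linarith
      norm_drift_le := fun s hs z hz => by
        refine (F'.le_opNorm _).trans (mul_le_mul_of_nonneg_left ?_ (norm_nonneg _))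
        exact (hg s hs _).trans (by gcongr; exact hball x hx z hz)
      abs_source_le := fun s hs z hz =>
        (hl s hs _).trans (by unfold M; gcongr; exact hball x hx z hz)
      abs_value_le := fun s hs z hz =>
        (hJK s hs _).trans (by unfold M; gcongr; exact hball x hx z hz) }
  have hterm : ∀ x ∈ closure O, ∀ z ∈ Metric.closedBall (F' x) 1,
      ∀ w ∈ Metric.closedBall (F' x) 1, |J T (F z) - J T (F w)| ≤ N * ‖z - w‖ := by
    intro x hx z hz w hw
    have hlip := (convex_closedBall (0 : Euc n) R').norm_image_sub_le_of_norm_fderiv_le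
      (𝕜 := ℝ) (f := lT) (C := K * (1 + R'))
      (fun y _ => (hlT.differentiable (by norm_num)) y)
      (fun y hy => by
        have h1 : ‖fderiv ℝ lT y‖ = ‖gradient lT y‖ := by
          rw [gradient, LinearIsometryEquiv.norm_map]
        rw [h1]
        exact (hDlT y).trans (by gcongr; exact mem_closedBall_zero_iff.1 hy))
      (mem_closedBall_zero_iff.2 (hball x hx w hw)) (mem_closedBall_zero_iff.2 (hball x hx z hz))
    rw [hJT, hJT, ← Real.norm_eq_abs]
    refine hlip.trans ?_
    unfold N
    rw [← map_sub, mul_assoc _ ‖F‖]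
    gcongr
    exact F.le_opNorm _
  have hspace : |J s₁ x₁ - J s₁ x₂| ≤ C₁ * ‖x₁ - x₂‖ ^ (2 * (1 / 4 : ℝ)) := by
    have hz : ‖F' x₁ - F' x₂‖ ≤ ‖F'‖ * ‖x₁ - x₂‖ := by
      rw [← map_sub]
      exact F'.le_opNorm _
    have hself : ∀ x, F' x ∈ Metric.closedBall (F' x) 1 := fun x =>
      Metric.mem_closedBall_self zero_le_one
    have h1 : |J s₁ x₁ - J s₁ x₂| ≤ (C + 2 * M) * ‖F' x₁ - F' x₂‖ := by
      rcases le_total ‖F' x₁ - F' x₂‖ 1 with h | h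
      · have := (hC t T _ _ _ _ (hsol x₂ hx₂) (hterm x₂ hx₂)).1 s₁ hs₁ (F' x₁)
          (mem_closedBall_iff_norm.2 h)
        simp only [hFF'] at this
        exact this.trans (by gcongr; linarith)
      · have b₁ := (hsol x₁ hx₁).abs_value_le s₁ hs₁ _ (hself x₁)
        have b₂ := (hsol x₂ hx₂).abs_value_le s₁ hs₁ _ (hself x₂)
        simp only [hFF'] at b₁ b₂
        have := abs_sub (J s₁ x₁) (J s₁ x₂)
        nlinarith [mul_le_mul_of_nonneg_left h (add_nonneg hC0 (mul_nonneg zero_le_two hM0))]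
    have h2 : ‖x₁ - x₂‖ ≤ (1 + 2 * R) * ‖x₁ - x₂‖ ^ (2 * (1 / 4 : ℝ)) :=
      le_one_add_mul_rpow (norm_nonneg _)
        ((norm_sub_le _ _).trans (by linarith [hR x₁ hx₁, hR x₂ hx₂])) (by norm_num) (by norm_num)
    calc |J s₁ x₁ - J s₁ x₂| ≤ (C + 2 * M) * (‖F'‖ * ‖x₁ - x₂‖) := h1.trans (by gcongr)
      _ ≤ (C + 2 * M) * (‖F'‖ * ((1 + 2 * R) * ‖x₁ - x₂‖ ^ (2 * (1 / 4 : ℝ)))) := by gcongr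
      _ = _ := by ring
  have htime : |J s₁ x₂ - J s₂ x₂| ≤ C₂ * |s₁ - s₂| ^ (1 / 4 : ℝ) := by
    have h1 := (hC t T _ _ _ _ (hsol x₂ hx₂) (hterm x₂ hx₂)).2 s₁ hs₁ s₂ hs₂
    simp only [hFF'] at h1
    have hle : |s₁ - s₂| ≤ T - t := abs_sub_le_iff.2
      ⟨by linarith [hs₁.2, hs₂.1], by linarith [hs₂.2, hs₁.1]⟩
    have h2 : |s₁ - s₂| ≤ (1 + (T - t)) * |s₁ - s₂| ^ (1 / 4 : ℝ) :=
      le_one_add_mul_rpow (abs_nonneg _) hle (by norm_num) (by norm_num)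
    have h3 : √|s₁ - s₂| ≤ (1 + √(T - t)) * |s₁ - s₂| ^ (1 / 4 : ℝ) := by
      have := le_one_add_mul_rpow (δ := 1 / 2) (Real.sqrt_nonneg |s₁ - s₂|)
        (Real.sqrt_le_sqrt hle) (by norm_num) (by norm_num)
      rw [Real.sqrt_eq_rpow, ← Real.rpow_mul (abs_nonneg _)] at this
      rw [Real.sqrt_eq_rpow |s₁ - s₂|]
      norm_num at this ⊢
      exact this
    calc |J s₁ x₂ - J s₂ x₂| ≤ C * (√|s₁ - s₂| + |s₁ - s₂|) := h1
      _ ≤ C * ((1 + √(T - t)) * |s₁ - s₂| ^ (1 / 4 : ℝ)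
          + (1 + (T - t)) * |s₁ - s₂| ^ (1 / 4 : ℝ)) := by gcongr
      _ = _ := by ring
  have hp₁ : 0 ≤ ‖x₁ - x₂‖ ^ (2 * (1 / 4 : ℝ)) := Real.rpow_nonneg (norm_nonneg _) _
  have hp₂ : 0 ≤ |s₁ - s₂| ^ (1 / 4 : ℝ) := Real.rpow_nonneg (abs_nonneg _) _
  have htri := abs_sub_le (J s₁ x₁) (J s₁ x₂) (J s₂ x₂)
  nlinarith [mul_nonneg hC₁ hp₂, mul_nonneg hC₂ hp₁]

end
end
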